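/- Let n ≥ 5. Then, as polynomials in x, P_{[2,n−2],[2,n−2]}(x) = x(x+1)[ binom(x+n−1, n−2) + binom(x−1, n−2) + binom(x, n−2) + binom(x+n−3, n−1) − binom(x+2, n−1) ] + x(x−1)[ binom(x−2, n−2) + binom(x+n−2, n−2) + binom(x+n−3, n−2) + binom(x+n−4, n−1) − binom(x+1, n−1) ], where [2,n−2] is the partition of n with one part 2 and one part n−2. -/

import Mathlib

open Polynomial
open scoped Classical

/-- The cycle type of a permutation of `Fin n` as a partition of `n`,
including fixed points as parts equal to `1`. -/
noncomputable def fullCycleType {n : ℕ} (σ : Equiv.Perm (Fin n)) : Multiset ℕ :=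
  σ.cycleType + Multiset.replicate (n - σ.cycleType.sum) 1

/-- The number of disjoint cycles of a permutation, fixed points included. -/
noncomputable def numCycles {n : ℕ} (σ : Equiv.Perm (Fin n)) : ℕ :=
  Multiset.card (fullCycleType σ)

/-- The set (conjugacy class) of permutations of `Fin n` with full cycle type `β`. -/
noncomputable def permClass (n : ℕ) (β : Multiset ℕ) : Finset (Equiv.Perm (Fin n)) :=
  Finset.univ.filter (fun ω => fullCycleType ω = β)

/-- The polynomial `P_{[2,n-2],β}(x) = (n(n-1)/|C_β|) ⬝ Σ_{ρ(ω)=β} x^{κ(αω)}`. -/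
noncomputable def Pperm {n : ℕ} (α : Equiv.Perm (Fin n)) (β : Multiset ℕ) : Polynomial ℚ :=
  Polynomial.C (((n : ℚ) * ((n : ℚ) - 1)) / ((permClass n β).card : ℚ)) *
    ∑ ω ∈ permClass n β, Polynomial.X ^ (numCycles (α * ω))

/-- The polynomial `binom(x + c, k)` in `x`: for `k ≥ 0` it is
`(x+c)(x+c-1)⋯(x+c-k+1)/k!`, and it is `0` for `k < 0`. -/
noncomputable def binomPoly (c k : ℤ) : Polynomial ℚ :=
  if 0 ≤ k then
    (((k.toNat).factorial : ℚ))⁻¹ •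
      ((descPochhammer ℚ k.toNat).comp (Polynomial.X + Polynomial.C (c : ℚ)))
  else 0

/-- The signless Stirling number of the first kind: the number of permutations of
an `N`-element set with exactly `m` cycles (fixed points included). -/
noncomputable def stirling1 (N m : ℕ) : ℕ :=
  (Finset.univ.filter (fun σ : Equiv.Perm (Fin N) => numCycles σ = m)).card

/-- For a Young diagram with row lengths `L` (rows and columns 0-indexed),
the product `∏_{u} (t + c(u))` over the cells `u`, `c(u)` being the content. -/
def contentProd (L : List ℕ) (t : ℤ) : ℤ :=
  ∏ i ∈ Finset.range L.length, ∏ j ∈ Finset.range (L.getD i 0), (t + (j : ℤ) - (i : ℤ))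

/-- `C(a, b)` for an integer `b`: the usual binomial coefficient when `b ≥ 0`
(which is `0` for `b > a`), and `0` when `b < 0`. -/
def chooseZ (a : ℕ) (b : ℤ) : ℚ := if 0 ≤ b then (a.choose b.toNat : ℚ) else 0

section SwapWeights

open Equiv Equiv.Perm

variable {Y : Type*} [Fintype Y] [DecidableEq Y]

/-- The permutations that fix every point outside `S`. -/
noncomputable def permsOn (S : Finset Y) : Finset (Perm Y) :=
  Finset.univ.filter fun ω => ∀ x, x ∉ S → ω x = x

/-- The permutations that fix every point outside `S` and permute `S` in a single cycle
(the only nonempty invariant subset of `S` is `S`). -/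
noncomputable def cyclesOn (S : Finset Y) : Finset (Perm Y) :=
  (permsOn S).filter fun ω => ∀ T ⊆ S, T.Nonempty → (∀ x ∈ T, ω x ∈ T) → T = S

theorem mem_permsOn {S : Finset Y} {ω : Perm Y} : ω ∈ permsOn S ↔ ∀ x, x ∉ S → ω x = x := by
  simp [permsOn]

theorem mem_cyclesOn {S : Finset Y} {ω : Perm Y} :
    ω ∈ cyclesOn S ↔ (∀ x, x ∉ S → ω x = x) ∧
      ∀ T ⊆ S, T.Nonempty → (∀ x ∈ T, ω x ∈ T) → T = S := by
  simp [cyclesOn, mem_permsOn]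

theorem cyclesOn_subset (S : Finset Y) : cyclesOn S ⊆ permsOn S := Finset.filter_subset _ _

theorem permsOn_mono {S T : Finset Y} (h : S ⊆ T) : permsOn S ⊆ permsOn T := fun _ hω =>
  mem_permsOn.2 fun x hx => mem_permsOn.1 hω x fun hx' => hx (h hx')

theorem apply_eq_of_mem_permsOn {S : Finset Y} {ω : Perm Y} (h : ω ∈ permsOn S) {x : Y}
    (hx : x ∉ S) : ω x = x := mem_permsOn.1 h x hx

theorem apply_eq_of_mem_cyclesOn {S : Finset Y} {ω : Perm Y} (h : ω ∈ cyclesOn S) {x : Y}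
    (hx : x ∉ S) : ω x = x := (mem_cyclesOn.1 h).1 x hx

theorem apply_mem_of_mem_permsOn {S : Finset Y} {ω : Perm Y} (h : ω ∈ permsOn S) {x : Y}
    (hx : x ∈ S) : ω x ∈ S := by
  by_contra hc
  have := mem_permsOn.1 h _ hc
  exact hc (by rwa [ω.injective this])

theorem mul_mem_permsOn {S : Finset Y} {ω σ : Perm Y} (h : ω ∈ permsOn S) (h' : σ ∈ permsOn S) :
    ω * σ ∈ permsOn S := mem_permsOn.2 fun x hx => by
  rw [Perm.mul_apply, mem_permsOn.1 h' x hx, mem_permsOn.1 h x hx]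

theorem inv_mem_permsOn {S : Finset Y} {ω : Perm Y} (h : ω ∈ permsOn S) :
    ω⁻¹ ∈ permsOn S := mem_permsOn.2 fun x hx => by
  rw [Perm.inv_eq_iff_eq, mem_permsOn.1 h x hx]

theorem swap_mem_permsOn {S : Finset Y} {a b : Y} (ha : a ∈ S) (hb : b ∈ S) :
    swap a b ∈ permsOn S := mem_permsOn.2 fun _ hx =>
  swap_apply_of_ne_of_ne (fun h => hx (h ▸ ha)) (fun h => hx (h ▸ hb))

theorem permsOn_empty : permsOn (∅ : Finset Y) = {1} := by
  ext ω
  simp [mem_permsOn, Perm.ext_iff]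

theorem cyclesOn_singleton (a : Y) : cyclesOn ({a} : Finset Y) = {1} := by
  ext ω
  rw [mem_cyclesOn, Finset.mem_singleton]
  refine ⟨fun h => ?_, ?_⟩
  · have h1 : ω ∈ permsOn {a} := mem_permsOn.2 h.1
    ext x
    by_cases hx : x = a
    · subst hx
      simpa using apply_mem_of_mem_permsOn h1 (Finset.mem_singleton_self x)
    · exact h.1 x (by simpa using hx)
  · rintro rfl
    refine ⟨fun _ _ => rfl, fun T hT hne _ => ?_⟩
    rcases Finset.subset_singleton_iff.1 hT with h | h
    · simp [h] at hne
    · exact h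

theorem swap_mul_mem_permsOn_insert {S : Finset Y} {a i : Y} {ω : Perm Y}
    (hi : i ∈ insert a S) (h : ω ∈ permsOn S) : swap a i * ω ∈ permsOn (insert a S) :=
  mul_mem_permsOn (swap_mem_permsOn (Finset.mem_insert_self a S) hi)
    (permsOn_mono (Finset.subset_insert a S) h)

theorem swap_mul_mem_permsOn {S : Finset Y} {a : Y} {ω : Perm Y}
    (h : ω ∈ permsOn (insert a S)) : swap a (ω a) * ω ∈ permsOn S := by
  rw [mem_permsOn] at h ⊢
  intro x hx
  rw [Perm.mul_apply]
  by_cases hxa : x = a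
  · subst hxa; simp
  · have hωx : ω x = x := h x (by simp [hx, hxa])
    rw [hωx, swap_apply_of_ne_of_ne hxa]
    intro hc
    exact hxa (ω.injective (hωx.trans hc))

theorem sum_permsOn_insert {M : Type*} [AddCommMonoid M] {S : Finset Y} {a : Y} (ha : a ∉ S)
    (f : Perm Y → M) :
    ∑ ω ∈ permsOn (insert a S), f ω
      = ∑ i ∈ insert a S, ∑ ω ∈ permsOn S, f (swap a i * ω) := by
  rw [← Finset.sum_product']
  refine (Finset.sum_nbij' (fun q => swap a q.1 * q.2) (fun ω => (ω a, swap a (ω a) * ω))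
    ?_ ?_ ?_ ?_ ?_).symm
  · rintro ⟨i, ω⟩ h
    rw [Finset.mem_product] at h
    exact swap_mul_mem_permsOn_insert h.1 h.2
  · intro ω h
    rw [Finset.mem_product]
    exact ⟨apply_mem_of_mem_permsOn h (Finset.mem_insert_self a S), swap_mul_mem_permsOn h⟩
  · rintro ⟨i, ω⟩ h
    rw [Finset.mem_product] at h
    simp [apply_eq_of_mem_permsOn h.2 ha]
  · intro ω h
    simp
  · intro q _
    rfl

theorem swap_mul_mem_cyclesOn_iff {S : Finset Y} {a i : Y} (ha : a ∉ S) (hi : i ∈ S)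
    {ω : Perm Y} (h : ω ∈ permsOn S) :
    swap a i * ω ∈ cyclesOn (insert a S) ↔ ω ∈ cyclesOn S := by
  have hωa : ω a = a := apply_eq_of_mem_permsOn h ha
  have hia : i ≠ a := fun hc => ha (hc ▸ hi)
  have hne : ∀ x, x ≠ a → ω x ≠ a := fun x hx hc => hx (ω.injective (hc.trans hωa.symm))
  rw [cyclesOn, cyclesOn, Finset.mem_filter, Finset.mem_filter]
  refine and_congr (iff_of_true (swap_mul_mem_permsOn_insert (by simp [hi]) h) h) ⟨?_, ?_⟩
  · intro H T hT hTn hTi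
    have haT : a ∉ T := fun hc => ha (hT hc)
    by_cases hiT : i ∈ T
    · have := H (insert a T) (Finset.insert_subset_insert a hT) (by simp) (by
        intro x hx
        rcases Finset.mem_insert.1 hx with rfl | hx
        · simp [hωa, hiT]
        · rw [Perm.mul_apply]
          by_cases hc : ω x = i
          · simp [hc]
          · rw [swap_apply_of_ne_of_ne (hne x fun hc => haT (hc ▸ hx)) hc]
            simp [hTi x hx])
      rw [← Finset.erase_insert haT, this, Finset.erase_insert ha]
    · have := H T (hT.trans (Finset.subset_insert a S)) hTn (by
        intro x hx
        have := hTi x hx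
        rwa [Perm.mul_apply, swap_apply_of_ne_of_ne (ne_of_mem_of_not_mem this haT)
          (ne_of_mem_of_not_mem this hiT)])
      exact absurd (this ▸ Finset.mem_insert_self a S) haT
  · intro H T hT hTn hTi
    have haT' : a ∈ T → i ∈ T := fun hc => by
      have := hTi a hc
      rwa [Perm.mul_apply, hωa, swap_apply_left] at this
    have key : T.erase a = S := by
      refine H _ (fun x hx => ?_) ?_ ?_
      · have hx' := Finset.mem_erase.1 hx
        exact (Finset.mem_insert.1 (hT hx'.2)).resolve_left hx'.1
      · obtain ⟨x, hx⟩ := hTn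
        by_cases hxa : x = a
        · exact ⟨i, Finset.mem_erase.2 ⟨hia, haT' (hxa ▸ hx)⟩⟩
        · exact ⟨x, Finset.mem_erase.2 ⟨hxa, hx⟩⟩
      · intro x hx
        have hx' := Finset.mem_erase.1 hx
        refine Finset.mem_erase.2 ⟨hne x hx'.1, ?_⟩
        have h2 := hTi x hx'.2
        rw [Perm.mul_apply] at h2
        by_cases hc : ω x = i
        · rw [hc, swap_apply_right] at h2
          exact hc ▸ haT' h2
        · rwa [swap_apply_of_ne_of_ne (hne x hx'.1) hc] at h2
    have haT : a ∈ T := by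
      have hj : ω⁻¹ i ∈ T.erase a := by
        rw [key]; exact apply_mem_of_mem_permsOn (inv_mem_permsOn h) hi
      have h2 := hTi _ (Finset.mem_erase.1 hj).2
      simpa using h2
    rw [← key, Finset.insert_erase haT]

theorem sum_cyclesOn_insert {M : Type*} [AddCommMonoid M] {S : Finset Y} (hS : S.Nonempty)
    {a : Y} (ha : a ∉ S) (f : Perm Y → M) :
    ∑ ω ∈ cyclesOn (insert a S), f ω = ∑ i ∈ S, ∑ ω ∈ cyclesOn S, f (swap a i * ω) := by
  rw [← Finset.sum_product']
  refine (Finset.sum_nbij' (fun q => swap a q.1 * q.2) (fun ω => (ω a, swap a (ω a) * ω))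
    ?_ ?_ ?_ ?_ ?_).symm
  · rintro ⟨i, ω⟩ h
    rw [Finset.mem_product] at h
    exact (swap_mul_mem_cyclesOn_iff ha h.1 (cyclesOn_subset S h.2)).2 h.2
  · intro ω h
    have h1 := cyclesOn_subset _ h
    have hmem : ω a ∈ S := by
      refine (Finset.mem_insert.1 (apply_mem_of_mem_permsOn h1 (by simp))).resolve_left ?_
      intro hc
      have := (mem_cyclesOn.1 h).2 {a} (by simp) (by simp) (by simp [hc])
      obtain ⟨x, hx⟩ := hS
      have hxa : x ∈ ({a} : Finset Y) := by rw [this]; simp [hx]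
      exact ha (Finset.mem_singleton.1 hxa ▸ hx)
    rw [Finset.mem_product]
    refine ⟨hmem, (swap_mul_mem_cyclesOn_iff ha hmem (swap_mul_mem_permsOn h1)).1 ?_⟩
    simpa using h
  · rintro ⟨i, ω⟩ h
    rw [Finset.mem_product] at h
    simp [apply_eq_of_mem_cyclesOn h.2 ha]
  · intro ω h
    simp
  · intro q _
    rfl

theorem sum_permsOn_apply {M : Type*} [AddCommMonoid M] {S : Finset Y} {ω : Perm Y}
    (h : ω ∈ permsOn S) (f : Y → M) : ∑ i ∈ S, f (ω i) = ∑ i ∈ S, f i :=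
  Finset.sum_nbij' ω (ω⁻¹ : Perm Y) (fun _ hx => apply_mem_of_mem_permsOn h hx)
    (fun _ hx => apply_mem_of_mem_permsOn (inv_mem_permsOn h) hx) (by simp) (by simp) (by simp)

theorem sum_cyclesOn_insert_right {M : Type*} [AddCommMonoid M] {S : Finset Y}
    (hS : S.Nonempty) {a : Y} (ha : a ∉ S) (f : Perm Y → M) :
    ∑ ω ∈ cyclesOn (insert a S), f ω = ∑ i ∈ S, ∑ ω ∈ cyclesOn S, f (ω * swap a i) := by
  rw [sum_cyclesOn_insert hS ha, Finset.sum_comm, Finset.sum_comm (s := S)]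
  refine Finset.sum_congr rfl fun ω hω => ?_
  rw [← sum_permsOn_apply (cyclesOn_subset S hω)]
  refine Finset.sum_congr rfl fun i _ => ?_
  rw [mul_swap_eq_swap_mul, apply_eq_of_mem_cyclesOn hω ha]

theorem sum_permsOn_mul_right {M : Type*} [AddCommMonoid M] {S : Finset Y} {σ : Perm Y}
    (h : σ ∈ permsOn S) (f : Perm Y → M) :
    ∑ ω ∈ permsOn S, f (ω * σ) = ∑ ω ∈ permsOn S, f ω :=
  Finset.sum_nbij' (· * σ) (· * σ⁻¹) (fun _ hx => mul_mem_permsOn hx h)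
    (fun _ hx => mul_mem_permsOn hx (inv_mem_permsOn h)) (by simp) (by simp) (by simp)

theorem sum_permsOn_mul_left {M : Type*} [AddCommMonoid M] {S : Finset Y} {σ : Perm Y}
    (h : σ ∈ permsOn S) (f : Perm Y → M) :
    ∑ ω ∈ permsOn S, f (σ * ω) = ∑ ω ∈ permsOn S, f ω :=
  Finset.sum_nbij' (σ * ·) (σ⁻¹ * ·) (fun _ hx => mul_mem_permsOn h hx)
    (fun _ hx => mul_mem_permsOn (inv_mem_permsOn h) hx) (by simp) (by simp) (by simp)

theorem card_cyclesOn {S : Finset Y} (hS : S.Nonempty) :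
    (cyclesOn S).card = (S.card - 1).factorial := by
  induction hS using Finset.Nonempty.cons_induction with
  | singleton a => simp [cyclesOn_singleton]
  | cons a S ha hS ih =>
    rw [Finset.cons_eq_insert, Finset.card_eq_sum_ones, sum_cyclesOn_insert hS ha]
    rw [Finset.card_insert_of_notMem ha]
    simp only [Finset.sum_const, smul_eq_mul, mul_one, ih, Nat.add_sub_cancel]
    exact Nat.mul_factorial_pred (Finset.card_pos.2 hS).ne'

/-- A permutation in `cyclesOn S` is a cycle with support `S`, provided `S` has two points. -/
theorem isCycle_of_mem_cyclesOn {S : Finset Y} (hS : 2 ≤ S.card) {ω : Perm Y}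
    (h : ω ∈ cyclesOn S) : ω.IsCycle ∧ ω.support = S := by
  have hmin := (mem_cyclesOn.1 h).2
  have hmove : ∀ x ∈ S, ω x ≠ x := fun x hx hc => by
    have := hmin {x} (by simpa using hx) (by simp) (by simp [hc])
    rw [← this] at hS
    simp at hS
  have hsupp : ω.support = S := by
    ext x
    rw [mem_support]
    refine ⟨fun hx => ?_, hmove x⟩
    by_contra hc
    exact hx (apply_eq_of_mem_cyclesOn h hc)
  obtain ⟨x, hx⟩ : S.Nonempty := Finset.card_pos.1 (by omega)
  have hall := hmin (S.filter fun y => ω.SameCycle x y) (Finset.filter_subset _ _)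
    ⟨x, by simp [hx, SameCycle.refl]⟩ (by
      intro y hy
      rw [Finset.mem_filter] at hy ⊢
      exact ⟨apply_mem_of_mem_permsOn (cyclesOn_subset S h) hy.1, hy.2.apply_right⟩)
  refine ⟨⟨x, hmove x hx, fun y hy => ?_⟩, hsupp⟩
  have hyS : y ∈ S := by rwa [← hsupp, mem_support]
  rw [← hall, Finset.mem_filter] at hyS
  exact hyS.2

theorem mem_cyclesOn_support {ω : Perm Y} (h : ω.IsCycle) : ω ∈ cyclesOn ω.support := by
  rw [mem_cyclesOn]
  refine ⟨fun x hx => notMem_support.1 hx, fun T hT ⟨x, hx⟩ hTi => hT.antisymm fun y hy => ?_⟩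
  obtain ⟨i, hi⟩ := h.exists_pow_eq (mem_support.1 (hT hx)) (mem_support.1 hy)
  have : ∀ k : ℕ, (ω ^ k) x ∈ T := fun k => by
    induction k with
    | zero => simpa using hx
    | succ k ih => rw [pow_succ', Perm.mul_apply]; exact hTi _ ih
  exact hi ▸ this i

/-- The least number of transpositions whose product is `σ`. -/
noncomputable def swapLength (σ : Perm Y) : ℕ := (σ.cycleType.map (· - 1)).sum

theorem swapLength_mul_of_disjoint {σ τ : Perm Y} (h : Perm.Disjoint σ τ) :
    swapLength (σ * τ) = swapLength σ + swapLength τ := by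
  simp [swapLength, h.cycleType_mul]

theorem swapLength_of_isCycle {σ : Perm Y} (h : σ.IsCycle) :
    swapLength σ = σ.support.card - 1 := by
  simp [swapLength, h.cycleType]

theorem swapLength_swap_mul {σ : Perm Y} {a p : Y} (ha : σ a = a) (hp : p ≠ a) :
    swapLength (swap a p * σ) = swapLength σ + 1 := by
  by_cases hσ : σ p = p
  · rw [swapLength_mul_of_disjoint, swapLength_of_isCycle (isCycle_swap hp.symm),
      card_support_swap hp.symm]
    · omega
    · intro x
      by_cases hxa : x = a
      · exact Or.inr (hxa ▸ ha)
      · by_cases hxp : x = p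
        · exact Or.inr (hxp ▸ hσ)
        · exact Or.inl (swap_apply_of_ne_of_ne hxa hxp)
  · set c := σ.cycleOf p with hc
    set τ := σ * c⁻¹ with hτ
    have hcyc : c.IsCycle := isCycle_cycleOf σ hσ
    have hdisj : Perm.Disjoint τ c := disjoint_mul_inv_of_mem_cycleFactorsFinset
      (cycleOf_mem_cycleFactorsFinset_iff.2 (mem_support.2 hσ))
    have hστ : σ = c * τ := by rw [← hdisj.commute.eq, hτ]; simp
    have hac : a ∉ c.support := fun h => mem_support.1 (support_cycleOf_le σ p h) ha
    have hpc : p ∈ c.support := by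
      rw [mem_support, hc, cycleOf_apply_self]; exact hσ
    have haτ : τ a = a := by
      have := ha
      rw [hστ, hdisj.commute.symm.eq, Perm.mul_apply, notMem_support.1 hac] at this
      exact this
    have hmem : swap a p * c ∈ cyclesOn (insert a c.support) :=
      (swap_mul_mem_cyclesOn_iff hac hpc (cyclesOn_subset _ (mem_cyclesOn_support hcyc))).2
        (mem_cyclesOn_support hcyc)
    have hcard := hcyc.two_le_card_support
    obtain ⟨h1, h2⟩ := isCycle_of_mem_cyclesOn
      (by rw [Finset.card_insert_of_notMem hac]; omega) hmem
    have hd : Perm.Disjoint (swap a p * c) τ := by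
      intro x
      by_cases hx : x ∈ insert a c.support
      · right
        rcases Finset.mem_insert.1 hx with rfl | hx
        · exact haτ
        · exact (hdisj x).resolve_right (mem_support.1 hx)
      · left
        rwa [← h2, notMem_support] at hx
    rw [hστ, ← mul_assoc, swapLength_mul_of_disjoint hd,
      swapLength_mul_of_disjoint hdisj.symm, swapLength_of_isCycle h1, swapLength_of_isCycle hcyc,
      h2, Finset.card_insert_of_notMem hac]
    omega

/-- The weight `y ^ (number of transpositions needed to write σ)`. -/
noncomputable def swapWeight (y : ℚ) (σ : Perm Y) : ℚ := y ^ swapLength σ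

variable (y : ℚ)

theorem swapWeight_mul_comm (σ τ : Perm Y) : swapWeight y (σ * τ) = swapWeight y (τ * σ) := by
  have : τ * σ = τ * (σ * τ) * τ⁻¹ := by group
  rw [swapWeight, swapWeight, swapLength, swapLength, this, cycleType_conj]

theorem swapWeight_one : swapWeight y (1 : Perm Y) = 1 := by
  simp [swapWeight, swapLength]

theorem swapWeight_swap_mul {σ : Perm Y} {a p : Y} (ha : σ a = a) (hp : p ≠ a) :
    swapWeight y (swap a p * σ) = y * swapWeight y σ := by
  rw [swapWeight, swapWeight, swapLength_swap_mul ha hp, pow_succ']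

/-- The product `(1 + 0 y)(1 + y) ⋯ (1 + (k - 1) y)`. -/
noncomputable def risingProd (y : ℚ) (k : ℕ) : ℚ := ∏ i ∈ Finset.range k, (1 + i * y)

theorem risingProd_succ (k : ℕ) : risingProd y (k + 1) = risingProd y k * (1 + k * y) :=
  Finset.prod_range_succ _ _

theorem sum_permsOn_char_mul_swapWeight (χ : Perm Y →* ℚ) (e : ℚ)
    (hχ : ∀ a b : Y, a ≠ b → χ (swap a b) = e) (S : Finset Y) {τ : Perm Y}
    (hτ : ∀ x ∈ S, τ x = x) :
    ∑ h ∈ permsOn S, χ h * swapWeight y (h * τ)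
      = risingProd (e * y) S.card * swapWeight y τ := by
  induction S using Finset.induction_on with
  | empty => simp [permsOn_empty, risingProd]
  | insert a S ha ih =>
    have ih' := ih fun x hx => hτ x (Finset.mem_insert_of_mem hx)
    rw [sum_permsOn_insert ha, Finset.sum_insert ha]
    have h1 : ∀ i ∈ S, ∑ ω ∈ permsOn S, χ (swap a i * ω) * swapWeight y (swap a i * ω * τ)
        = e * y * (risingProd (e * y) S.card * swapWeight y τ) := by
      intro i hi
      have hia : i ≠ a := ne_of_mem_of_not_mem hi ha
      rw [← ih', Finset.mul_sum]
      refine Finset.sum_congr rfl fun ω hω => ?_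
      rw [mul_assoc (swap a i), swapWeight_swap_mul y _ hia, map_mul, hχ a i hia.symm]
      · ring
      · rw [Perm.mul_apply, hτ a (by simp), apply_eq_of_mem_permsOn hω ha]
    rw [Finset.sum_congr rfl h1, Finset.card_insert_of_notMem ha, risingProd_succ]
    simp only [swap_self, Finset.sum_const, nsmul_eq_mul]
    have h2 : ∑ ω ∈ permsOn S, χ (Equiv.refl Y * ω) * swapWeight y (Equiv.refl Y * ω * τ)
        = risingProd (e * y) S.card * swapWeight y τ := ih'
    rw [h2]
    ring

/-- The sign character with values in `ℚ`. -/
noncomputable def signQ : Perm Y →* ℚ :=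
  ((Int.castRingHom ℚ : ℤ →* ℚ).comp (Units.coeHom ℤ)).comp Perm.sign

theorem signQ_swap {a b : Y} (h : a ≠ b) : signQ (swap a b) = -1 := by
  simp [signQ, sign_swap h]

theorem signQ_mul_self (σ : Perm Y) : signQ σ * signQ σ = 1 := by
  rcases Int.units_eq_one_or (Perm.sign σ) with h | h <;> simp [signQ, h]

theorem signQ_of_mem_cyclesOn {S : Finset Y} (hS : S.Nonempty) :
    ∀ ω ∈ cyclesOn S, signQ ω = (-1) ^ (S.card - 1) := by
  intro ω hω
  by_cases h2 : 2 ≤ S.card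
  · obtain ⟨h, h'⟩ := isCycle_of_mem_cyclesOn h2 hω
    have : signQ ω = ((Perm.sign ω : ℤ) : ℚ) := rfl
    rw [this, h.sign, h']
    obtain ⟨k, hk⟩ : ∃ k, S.card = k + 1 := ⟨S.card - 1, by omega⟩
    simp [hk, pow_succ]
  · have h1 : S.card = 1 := by have := hS.card_pos; omega
    obtain ⟨a, rfl⟩ := Finset.card_eq_one.1 h1
    rw [cyclesOn_singleton, Finset.mem_singleton] at hω
    simp [hω]

theorem commute_of_mem_permsOn {S T : Finset Y} (h : Disjoint S T) {σ τ : Perm Y}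
    (hσ : σ ∈ permsOn S) (hτ : τ ∈ permsOn T) : σ * τ = τ * σ := by
  refine Perm.Disjoint.commute fun x => ?_
  by_cases hx : x ∈ S
  · exact Or.inr (apply_eq_of_mem_permsOn hτ (Finset.disjoint_left.1 h hx))
  · exact Or.inl (apply_eq_of_mem_permsOn hσ hx)

/-- Inclusion-exclusion over the blocks containing `a`: the full cycles on `insert a R` as a
signed sum over the two-block subgroups. -/
theorem sum_cyclesOn_eq_signed_sum {R : Finset Y} {a : Y} (ha : a ∉ R) (f : Perm Y → ℚ) :
    ∑ ω ∈ cyclesOn (insert a R), f ω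
      = ∑ S ∈ R.powerset, (-1) ^ S.card *
          ∑ h ∈ permsOn (insert a S), ∑ k ∈ permsOn (R \ S), signQ h * f (h * k) := by
  induction R using Finset.induction_on generalizing f with
  | empty =>
    have h1 : permsOn ({a} : Finset Y) = {1} := by
      rw [← insert_empty_eq]
      ext ω
      refine ⟨fun h => ?_, fun h => ?_⟩
      · have h2 : ω ∈ cyclesOn ({a} : Finset Y) := by
          rw [mem_cyclesOn]
          refine ⟨mem_permsOn.1 h, fun T hT hne _ => ?_⟩
          exact (Finset.subset_singleton_iff.1 hT).resolve_left hne.ne_empty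
        rwa [cyclesOn_singleton] at h2
      · rw [Finset.mem_singleton.1 h]
        exact mem_permsOn.2 fun _ _ => rfl
    simp [cyclesOn_singleton, permsOn_empty, h1]
  | insert b R hb ih =>
    have hab : a ≠ b := fun h => ha (by simp [h])
    have haR : a ∉ R := fun h => ha (by simp [h])
    have hbaR : b ∉ insert a R := by simp [hb, hab.symm]
    rw [Finset.insert_comm, sum_cyclesOn_insert (by simp) hbaR, Finset.sum_comm]
    rw [ih haR, Finset.sum_powerset_insert hb, ← Finset.sum_add_distrib]
    refine Finset.sum_congr rfl fun S hS => ?_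
    rw [Finset.mem_powerset] at hS
    have hbS : b ∉ S := fun h => hb (hS h)
    have haS : a ∉ S := fun h => haR (hS h)
    have hbaS : b ∉ insert a S := by simp [hbS, hab.symm]
    have e1 : insert b R \ S = insert b (R \ S) := Finset.insert_sdiff_of_notMem _ hbS
    have e2 : insert b R \ insert b S = R \ S := by
      ext x; simp only [Finset.mem_sdiff, Finset.mem_insert]
      constructor
      · rintro ⟨h1, h2⟩; exact ⟨h1.resolve_left fun h => h2 (Or.inl h), fun h => h2 (Or.inr h)⟩
      · rintro ⟨h1, h2⟩
        exact ⟨Or.inr h1, fun h => h.elim (fun h => hb (h ▸ h1)) h2⟩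
    have hbRS : b ∉ R \ S := fun h => hb (Finset.mem_sdiff.1 h).1
    rw [e1, e2, Finset.insert_comm, Finset.card_insert_of_notMem hbS, sum_permsOn_insert hbaS,
      Finset.sum_insert hbaS, Finset.sum_congr rfl fun h _ => sum_permsOn_insert hbRS _]
    have hdisj : Disjoint (insert a S) (insert b (R \ S)) := by
      rw [Finset.disjoint_left]
      intro x hx hx'
      rcases Finset.mem_insert.1 hx with rfl | hx
      · simp [hab, haR] at hx'
      · rcases Finset.mem_insert.1 hx' with rfl | hx'
        · exact hbS hx
        · exact (Finset.mem_sdiff.1 hx').2 hx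
    have hA : ∑ h ∈ permsOn (insert a S), ∑ i ∈ insert b (R \ S), ∑ k ∈ permsOn (R \ S),
          signQ h * f (h * (swap b i * k))
        = ∑ i ∈ insert b (R \ S), ∑ h ∈ permsOn (insert a S), ∑ k ∈ permsOn (R \ S),
          signQ h * f (swap b i * (h * k)) := by
      rw [Finset.sum_comm]
      refine Finset.sum_congr rfl fun i hi => Finset.sum_congr rfl fun h hh =>
        Finset.sum_congr rfl fun k _ => ?_
      rw [← mul_assoc, commute_of_mem_permsOn hdisj hh
        (swap_mem_permsOn (Finset.mem_insert_self _ _) hi), mul_assoc]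
    have hB : ∑ i ∈ insert a S, ∑ h ∈ permsOn (insert a S), ∑ k ∈ permsOn (R \ S),
          signQ (swap b i * h) * f (swap b i * h * k)
        = - ∑ i ∈ insert a S, ∑ h ∈ permsOn (insert a S), ∑ k ∈ permsOn (R \ S),
          signQ h * f (swap b i * (h * k)) := by
      simp_rw [← Finset.sum_neg_distrib]
      refine Finset.sum_congr rfl fun i hi => Finset.sum_congr rfl fun h hh =>
        Finset.sum_congr rfl fun k _ => ?_
      rw [map_mul, signQ_swap (ne_of_mem_of_not_mem hi hbaS).symm, mul_assoc (swap b i)]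
      ring
    have hR : insert a R = insert a S ∪ R \ S := by
      rw [Finset.insert_union, Finset.union_sdiff_of_subset hS]
    have hdisj' : Disjoint (insert a S) (R \ S) :=
      hdisj.mono_right (Finset.subset_insert _ _)
    have hC : ∑ h ∈ permsOn (insert a S), ∑ k ∈ permsOn (R \ S),
          signQ h * ∑ i ∈ insert a R, f (swap b i * (h * k))
        = (∑ i ∈ insert a S, ∑ h ∈ permsOn (insert a S), ∑ k ∈ permsOn (R \ S),
            signQ h * f (swap b i * (h * k)))
          + ∑ i ∈ R \ S, ∑ h ∈ permsOn (insert a S), ∑ k ∈ permsOn (R \ S),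
            signQ h * f (swap b i * (h * k)) := by
      rw [hR, ← Finset.sum_union hdisj', Finset.sum_comm (s := insert a S ∪ R \ S)]
      refine Finset.sum_congr rfl fun h _ => ?_
      rw [Finset.sum_comm (s := insert a S ∪ R \ S)]
      simp_rw [Finset.mul_sum]
    rw [hA, hB, hC, Finset.sum_insert hbRS]
    have h1 : swap b b = (1 : Perm Y) := swap_self b
    simp only [h1, one_mul]
    ring

/-- The signed sum of the weights of `g h k` over the block permutations `h` of `S`, `k` of `T`. -/
noncomputable def signedSum (S T : Finset Y) (g : Perm Y) : ℚ :=
  ∑ h ∈ permsOn S, ∑ k ∈ permsOn T, signQ h * swapWeight y (g * (h * k))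

section SignedSum

variable {y} {S T : Finset Y}

theorem signedSum_mul_left {σ : Perm Y} (hσ : σ ∈ permsOn T) (g : Perm Y) :
    signedSum y S T (σ * g) = signedSum y S T g := by
  refine Finset.sum_congr rfl fun h _ => ?_
  rw [← sum_permsOn_mul_right hσ (fun k => signQ h * swapWeight y (g * (h * k)))]
  refine Finset.sum_congr rfl fun k _ => ?_
  rw [mul_assoc, swapWeight_mul_comm]
  simp only [mul_assoc]

theorem signedSum_mul_right (hST : Disjoint S T) {σ : Perm Y} (hσ : σ ∈ permsOn T)
    (g : Perm Y) : signedSum y S T (g * σ) = signedSum y S T g := by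
  refine Finset.sum_congr rfl fun h hh => ?_
  rw [← sum_permsOn_mul_left hσ (fun k => signQ h * swapWeight y (g * (h * k)))]
  refine Finset.sum_congr rfl fun k _ => ?_
  rw [mul_assoc, ← mul_assoc σ, ← commute_of_mem_permsOn hST hh hσ, mul_assoc]

theorem signedSum_mul_right_sign {σ : Perm Y} (hσ : σ ∈ permsOn S) (g : Perm Y) :
    signedSum y S T (g * σ) = signQ σ * signedSum y S T g := by
  rw [signedSum, signedSum, Finset.mul_sum,
    ← sum_permsOn_mul_left hσ (fun h => signQ σ * ∑ k ∈ permsOn T,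
      signQ h * swapWeight y (g * (h * k)))]
  refine Finset.sum_congr rfl fun h _ => ?_
  rw [Finset.mul_sum]
  refine Finset.sum_congr rfl fun k _ => ?_
  rw [map_mul, ← mul_assoc (signQ σ), ← mul_assoc (signQ σ), signQ_mul_self, one_mul]
  simp only [mul_assoc]

/-- The signed sum vanishes when two points of `S` leave `S` into `T`. -/
theorem signedSum_eq_zero {g : Perm Y} {s s' : Y} (hs : s ∈ S)
    (hs' : s' ∈ S) (hne : s ≠ s') (h : g s ∈ T) (h' : g s' ∈ T) : signedSum y S T g = 0 := by
  have h1 := signedSum_mul_left (y := y) (S := S) (swap_mem_permsOn h h') g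
  rw [← mul_swap_eq_swap_mul, signedSum_mul_right_sign (swap_mem_permsOn hs hs'),
    signQ_swap hne] at h1
  linarith

theorem signedSum_one (hST : Disjoint S T) :
    signedSum y S T 1 = risingProd (-y) S.card * risingProd y T.card := by
  have hT : ∑ k ∈ permsOn T, swapWeight y k = risingProd y T.card := by
    have := sum_permsOn_char_mul_swapWeight y (1 : Perm Y →* ℚ) 1 (fun _ _ _ => rfl) T
      (τ := 1) (fun _ _ => rfl)
    simpa [swapWeight_one] using this
  rw [signedSum, Finset.sum_comm, ← hT, Finset.mul_sum]
  refine Finset.sum_congr rfl fun k hk => ?_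
  have := sum_permsOn_char_mul_swapWeight y (signQ : Perm Y →* ℚ) (-1)
    (fun _ _ h => signQ_swap h) S (τ := k)
    (fun x hx => apply_eq_of_mem_permsOn hk (Finset.disjoint_left.1 hST hx))
  simpa using this

theorem signedSum_swap (hST : Disjoint S T) {u t : Y} (hu : u ∈ S) (ht : t ∈ T) :
    signedSum y S T (swap u t) = y * risingProd (-y) S.card * risingProd y T.card := by
  induction S using Finset.induction_on generalizing u with
  | empty => simp at hu
  | insert a S ha ih =>
    have haT : a ∉ T := Finset.disjoint_left.1 hST (by simp)
    have hST' : Disjoint S T := hST.mono_left (Finset.subset_insert _ _)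
    have hat : t ≠ a := ne_of_mem_of_not_mem ht haT
    have base : signedSum y (insert a S) T (swap a t)
        = y * risingProd (-y) (insert a S).card * risingProd y T.card := by
      rw [signedSum, sum_permsOn_insert ha, Finset.sum_insert ha]
      have h0 : ∑ h ∈ permsOn S, ∑ k ∈ permsOn T,
            signQ (swap a a * h) * swapWeight y (swap a t * (swap a a * h * k))
          = y * signedSum y S T 1 := by
        rw [signedSum, Finset.mul_sum]
        refine Finset.sum_congr rfl fun h hh => ?_
        rw [Finset.mul_sum]
        refine Finset.sum_congr rfl fun k hk => ?_
        have h1 : swap a a = (1 : Perm Y) := swap_self a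
        rw [h1, one_mul, one_mul, swapWeight_swap_mul y _ hat]
        · ring
        · rw [Perm.mul_apply, apply_eq_of_mem_permsOn hk haT, apply_eq_of_mem_permsOn hh ha]
      have h1 : ∀ i ∈ S, ∑ h ∈ permsOn S, ∑ k ∈ permsOn T,
            signQ (swap a i * h) * swapWeight y (swap a t * (swap a i * h * k))
          = - y * (y * risingProd (-y) S.card * risingProd y T.card) := by
        intro i hi
        have hia : i ≠ a := ne_of_mem_of_not_mem hi ha
        have hit : i ≠ t := fun h => Finset.disjoint_left.1 hST' hi (h ▸ ht)
        rw [← ih hST' hi, signedSum, Finset.mul_sum]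
        refine Finset.sum_congr rfl fun h hh => ?_
        rw [Finset.mul_sum]
        refine Finset.sum_congr rfl fun k hk => ?_
        have h2 : swap a t * (swap a i * h * k) = swap a i * (swap i t * (h * k)) := by
          have : swap a t * swap a i = swap a i * swap i t := by
            rw [swap_mul_eq_mul_swap, swap_inv, swap_apply_left,
              swap_apply_of_ne_of_ne hat hit.symm]
          rw [mul_assoc, ← mul_assoc, this, mul_assoc]
        rw [h2, swapWeight_swap_mul y _ hia, map_mul, signQ_swap hia.symm]
        · ring
        · rw [Perm.mul_apply, Perm.mul_apply, apply_eq_of_mem_permsOn hk haT,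
            apply_eq_of_mem_permsOn hh ha, swap_apply_of_ne_of_ne hia.symm hat.symm]
      rw [h0, Finset.sum_congr rfl h1, signedSum_one hST', Finset.card_insert_of_notMem ha,
        risingProd_succ]
      simp only [Finset.sum_const, nsmul_eq_mul]
      ring
    by_cases hua : u = a
    · exact hua ▸ base
    · have hut : u ≠ t := fun h => Finset.disjoint_left.1 hST hu (h ▸ ht)
      have hau : a ≠ u := fun h => hua h.symm
      have h3 : swap u t * swap a u = swap a u * swap a t := by
        rw [swap_mul_eq_mul_swap, swap_inv, swap_apply_right,
          swap_apply_of_ne_of_ne hat hut.symm]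
      have h4 := signedSum_mul_right_sign (y := y) (T := T)
        (swap_mem_permsOn (Finset.mem_insert_self a S) hu) (swap u t)
      have h5 : signedSum y (insert a S) T (swap a u * swap a t)
          = - signedSum y (insert a S) T (swap a t) := by
        rw [signedSum, signedSum, ← Finset.sum_neg_distrib,
          ← sum_permsOn_mul_right (swap_mem_permsOn (Finset.mem_insert_self a S) hu)
            (fun h => - ∑ k ∈ permsOn T, signQ h * swapWeight y (swap a t * (h * k)))]
        refine Finset.sum_congr rfl fun h _ => ?_
        rw [← Finset.sum_neg_distrib]
        refine Finset.sum_congr rfl fun k hk => ?_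
        rw [map_mul, signQ_swap hau, mul_assoc (swap a u), swapWeight_mul_comm]
        have : h * swap a u * k = h * k * swap a u := by
          rw [mul_assoc, commute_of_mem_permsOn hST
            (swap_mem_permsOn (Finset.mem_insert_self a S) hu) hk, mul_assoc]
        rw [this]
        simp only [mul_assoc]
        ring
      rw [h3, h5, signQ_swap hau, base] at h4
      linarith

end SignedSum

theorem sum_signedSum_swap_mul {S T W : Finset Y} (hS : S.Nonempty) (hST : Disjoint S T)
    (hSW : S ⊂ W) (hWT : W ⊆ T ∪ S) {b : Y} (hbT : b ∈ T) (hbW : b ∉ W) {α : Perm Y}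
    (hα : α ∈ cyclesOn W) :
    ∑ i ∈ S, signedSum y S T (swap b i * α) = signedSum y S T α := by
  have hWT' : ∀ x ∈ W, x ∉ S → x ∈ T := fun x hx hxS =>
    (Finset.mem_union.1 (hWT hx)).resolve_right hxS
  have hαW : ∀ x ∈ W, α x ∈ W := fun x hx => apply_mem_of_mem_permsOn (cyclesOn_subset W hα) hx
  have hαT : ∀ x ∈ S, α x ∉ S → α x ∈ T := fun x hx h => hWT' _ (hαW x (hSW.1 hx)) h
  obtain ⟨s, hs, hsS⟩ : ∃ s ∈ S, α s ∉ S := by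
    by_contra! h
    exact hSW.ne ((mem_cyclesOn.1 hα).2 S hSW.1 hS h)
  have hterm : ∀ i ∈ S, signedSum y S T (swap b i * α)
      = if α⁻¹ i ∉ S then signedSum y S T α else 0 := by
    intro i hi
    have hr : α (α⁻¹ i) = i := by simp
    rw [ite_not]
    split_ifs with h
    · refine signedSum_eq_zero h hs ?_ ?_ ?_
      · rintro rfl
        exact hsS (hr.symm ▸ hi)
      · rw [Perm.mul_apply, hr, swap_apply_right]
        exact hbT
      · rw [Perm.mul_apply, swap_apply_of_ne_of_ne]
        · exact hαT s hs hsS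
        · exact fun h' => hbW (h' ▸ hαW s (hSW.1 hs))
        · exact fun h' => hsS (h'.symm ▸ hi)
    · have hb : α⁻¹ b = b := by
        rw [Perm.inv_eq_iff_eq, apply_eq_of_mem_cyclesOn hα hbW]
      rw [swap_mul_eq_mul_swap, hb]
      refine signedSum_mul_right hST (swap_mem_permsOn hbT (hWT' _ ?_ h)) α
      exact apply_mem_of_mem_permsOn (inv_mem_permsOn (cyclesOn_subset W hα)) (hSW.1 hi)
  have hcard : (S.filter fun i => α⁻¹ i ∉ S).card = (S.filter fun i => α i ∉ S).card := by
    have h1 := S.card_filter_add_card_filter_not (fun i => α⁻¹ i ∈ S)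
    have h2 := S.card_filter_add_card_filter_not (fun i => α i ∈ S)
    have h3 : (S.filter fun i => α⁻¹ i ∈ S).card = (S.filter fun i => α i ∈ S).card :=
      Finset.card_nbij' (α⁻¹ : Perm Y) α (fun i hi => by simp_all) (fun i hi => by simp_all)
        (fun i _ => α.apply_symm_apply i) (fun i _ => α.symm_apply_apply i)
    omega
  rw [Finset.sum_congr rfl hterm, ← Finset.sum_filter, Finset.sum_const, hcard, nsmul_eq_mul]
  rcases Nat.lt_or_ge 1 (S.filter fun i => α i ∉ S).card with h | h
  · obtain ⟨u, hu, v, hv, huv⟩ := Finset.one_lt_card.1 h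
    rw [Finset.mem_filter] at hu hv
    rw [signedSum_eq_zero hu.1 hv.1 huv (hαT u hu.1 hu.2) (hαT v hv.1 hv.2), mul_zero]
  · have h' : (S.filter fun i => α i ∉ S).card = 1 :=
      le_antisymm h (Finset.card_pos.2 ⟨s, Finset.mem_filter.2 ⟨hs, hsS⟩⟩)
    rw [h', Nat.cast_one, one_mul]

theorem sum_cyclesOn_signedSum {S T U : Finset Y} (hS : S.Nonempty) (hST : Disjoint S T)
    (hUT : U ⊆ T) (hU : U.Nonempty) :
    ∑ α ∈ cyclesOn (U ∪ S), signedSum y S T α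
      = (-1) ^ (S.card - 1) * S.card.factorial * U.card.factorial
        * (y * risingProd (-y) S.card * risingProd y T.card) := by
  induction hU using Finset.Nonempty.cons_induction with
  | singleton b =>
    have hbT : b ∈ T := hUT (by simp)
    have hbS : b ∉ S := Finset.disjoint_right.1 hST hbT
    rw [← Finset.insert_eq, sum_cyclesOn_insert hS hbS]
    have h1 : ∀ i ∈ S, ∑ α ∈ cyclesOn S, signedSum y S T (swap b i * α)
        = (S.card - 1).factorial * ((-1) ^ (S.card - 1)
          * (y * risingProd (-y) S.card * risingProd y T.card)) := by
      intro i hi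
      have h2 : ∀ α ∈ cyclesOn S, signedSum y S T (swap b i * α)
          = (-1) ^ (S.card - 1) * (y * risingProd (-y) S.card * risingProd y T.card) := by
        intro α hα
        rw [signedSum_mul_right_sign (cyclesOn_subset S hα), signQ_of_mem_cyclesOn hS α hα,
          swap_comm, signedSum_swap hST hi hbT]
      rw [Finset.sum_congr rfl h2, Finset.sum_const, card_cyclesOn hS, nsmul_eq_mul]
    rw [Finset.sum_congr rfl h1, Finset.sum_const, nsmul_eq_mul,
      ← Nat.mul_factorial_pred hS.card_pos.ne']
    push_cast
    simp
    ring
  | cons b U hb hU ih =>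
    rw [Finset.cons_eq_insert] at hUT ⊢
    have hbT : b ∈ T := hUT (by simp)
    have hUT' : U ⊆ T := (Finset.subset_insert b U).trans hUT
    have hbS : b ∉ S := Finset.disjoint_right.1 hST hbT
    have hbW : b ∉ U ∪ S := by simp [hb, hbS]
    rw [Finset.insert_union, sum_cyclesOn_insert (hS.mono Finset.subset_union_right) hbW,
      Finset.sum_comm]
    have hUS : Disjoint U S := (hST.mono_right hUT').symm
    have h1 : ∀ α ∈ cyclesOn (U ∪ S), ∑ i ∈ U ∪ S, signedSum y S T (swap b i * α)
        = (U.card + 1) * signedSum y S T α := by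
      intro α hα
      rw [Finset.sum_union hUS, sum_signedSum_swap_mul y hS hST ?_
        (Finset.union_subset_union_left hUT') hbT hbW hα]
      · rw [Finset.sum_congr rfl fun i hi =>
          signedSum_mul_left (swap_mem_permsOn hbT (hUT' hi)) α, Finset.sum_const, nsmul_eq_mul]
        ring
      · obtain ⟨u, hu⟩ := hU
        exact Finset.ssubset_iff_subset_ne.2 ⟨Finset.subset_union_right, fun h =>
          Finset.disjoint_left.1 hUS hu (h ▸ Finset.mem_union_left S hu)⟩
    rw [Finset.sum_congr rfl h1, ← Finset.mul_sum, ih hUT', Finset.card_insert_of_notMem hb,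
      Nat.factorial_succ]
    push_cast
    ring

theorem risingProd_mul_succ_sub (j k : ℕ) :
    risingProd (-y) j * risingProd y (k + 1) - risingProd (-y) (j + 1) * risingProd y k
      = (j + k) * (y * (risingProd (-y) j * risingProd y k)) := by
  rw [risingProd_succ, risingProd_succ]
  ring

theorem sum_range_succ_mul_sub (f : ℕ → ℚ) (M : ℕ) :
    ∑ i ∈ Finset.range M, (i + 1 : ℚ) * (f i - f (i + 1)) + (M + 1) * f M
      = ∑ i ∈ Finset.range (M + 1), f i := by
  induction M with
  | zero => simp
  | succ M ih =>
    rw [Finset.sum_range_succ, Finset.sum_range_succ _ (M + 1), ← ih]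
    push_cast
    ring

theorem risingProd_zero : risingProd y 0 = 1 := Finset.prod_range_zero _

theorem risingProd_one : risingProd y 1 = 1 := by simp [risingProd]

theorem mul_risingProd_convolution (M : ℕ) :
    (M + 1) * (M + 2) * (y * (risingProd (-y) (M + 1) + ∑ i ∈ Finset.range M,
        (i + 1) * (y * (risingProd (-y) (i + 1) * risingProd y (M - i)))))
      = risingProd y (M + 2) - risingProd (-y) (M + 2) := by
  have h1 : (M + 1) * (risingProd (-y) (M + 1) + ∑ i ∈ Finset.range M,
        (i + 1) * (y * (risingProd (-y) (i + 1) * risingProd y (M - i))))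
      = ∑ i ∈ Finset.range (M + 1), risingProd (-y) (i + 1) * risingProd y (M + 1 - i) := by
    rw [← sum_range_succ_mul_sub, mul_add, Finset.mul_sum, add_comm]
    congr 1
    · refine Finset.sum_congr rfl fun i hi => ?_
      have hi' : i < M := Finset.mem_range.1 hi
      have h := risingProd_mul_succ_sub y (i + 1) (M - i)
      rw [show M - i + 1 = M + 1 - i by omega] at h
      rw [show M + 1 - (i + 1) = M - i by omega, h]
      push_cast [hi'.le]
      ring
    · rw [Nat.add_sub_cancel_left, risingProd_one, mul_one]
  have h2 : (M + 2) * (y * ∑ i ∈ Finset.range (M + 1),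
        risingProd (-y) (i + 1) * risingProd y (M + 1 - i))
      = risingProd y (M + 2) - risingProd (-y) (M + 2) := by
    rw [Finset.mul_sum, Finset.mul_sum, Finset.sum_congr rfl (g := fun i =>
      risingProd (-y) (i + 1) * risingProd y (M + 2 - i)
        - risingProd (-y) (i + 1 + 1) * risingProd y (M + 2 - (i + 1))), Finset.sum_range_sub']
    · rw [show M + 2 - (M + 1) = 1 by omega]
      simp [risingProd_one]
    · intro i hi
      have hi' : i ≤ M := Nat.lt_succ_iff.1 (Finset.mem_range.1 hi)
      have h := risingProd_mul_succ_sub y (i + 1) (M + 1 - i)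
      rw [show M + 1 - i + 1 = M + 2 - i by omega] at h
      rw [show M + 2 - (i + 1) = M + 1 - i by omega, h]
      push_cast [hi'.trans (Nat.le_succ M)]
      ring
  rw [← h2, ← h1]
  ring

/-- The sum of the weights of the products of two full cycles on `R`. -/
noncomputable def cycleProductSum (R : Finset Y) : ℚ :=
  ∑ z ∈ cyclesOn R, ∑ w ∈ cyclesOn R, swapWeight y (z * w)

theorem cycleProductSum_insert_eq {R : Finset Y} {a : Y} (ha : a ∉ R) :
    cycleProductSum y (insert a R) = R.card.factorial * (risingProd (-y) (R.card + 1)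
      + ∑ i ∈ Finset.range R.card,
        (i + 1) * (y * (risingProd (-y) (i + 1) * risingProd y (R.card - i)))) := by
  obtain ⟨F, hF⟩ : ∃ F : ℕ → ℚ, F = fun j =>
      if j = R.card then R.card.factorial * risingProd (-y) (R.card + 1)
      else (j + 1).factorial * (R.card - j).factorial
        * (y * (risingProd (-y) (j + 1) * risingProd y (R.card - j))) := ⟨_, rfl⟩
  have h1 : ∀ S ∈ R.powerset, (-1 : ℚ) ^ S.card *
        ∑ z ∈ cyclesOn (insert a R), signedSum y (insert a S) (R \ S) z
      = F S.card := by
    intro S hS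
    rw [hF]
    rw [Finset.mem_powerset] at hS
    have haS : a ∉ S := fun h => ha (hS h)
    have hsq : (-1 : ℚ) ^ S.card * (-1) ^ S.card = 1 := by
      rw [← mul_pow]; simp
    have hdisj : Disjoint (insert a S) (R \ S) := by
      rw [Finset.disjoint_insert_left]
      exact ⟨fun h => ha (Finset.mem_sdiff.1 h).1, Finset.disjoint_sdiff⟩
    by_cases hSR : S = R
    · subst hSR
      have h2 : ∀ z ∈ cyclesOn (insert a S), signedSum y (insert a S) (S \ S) z
          = (-1) ^ S.card * risingProd (-y) (S.card + 1) := by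
        intro z hz
        rw [← one_mul z, signedSum_mul_right_sign (cyclesOn_subset _ hz),
          signQ_of_mem_cyclesOn (by simp) z hz, signedSum_one hdisj,
          Finset.card_insert_of_notMem haS]
        simp [risingProd_zero]
      rw [Finset.sum_congr rfl h2, Finset.sum_const, card_cyclesOn (by simp),
        Finset.card_insert_of_notMem haS, nsmul_eq_mul]
      simp only [if_true, Nat.add_sub_cancel]
      linear_combination (S.card.factorial * risingProd (-y) (S.card + 1) : ℚ) * hsq
    · have hlt : S.card < R.card := Finset.card_lt_card (hS.ssubset_of_ne hSR)
      have hne : (R \ S).Nonempty := by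
        rw [← Finset.card_pos, Finset.card_sdiff_of_subset hS]
        omega
      have hU : insert a R = (R \ S) ∪ insert a S := by
        rw [Finset.union_insert, Finset.sdiff_union_of_subset hS]
      rw [hU, sum_cyclesOn_signedSum y (by simp) hdisj subset_rfl hne,
        Finset.card_insert_of_notMem haS, Finset.card_sdiff_of_subset hS]
      simp only [if_neg hlt.ne, Nat.add_sub_cancel]
      linear_combination ((S.card + 1).factorial * (R.card - S.card).factorial
        * (y * (risingProd (-y) (S.card + 1) * risingProd y (R.card - S.card))) : ℚ) * hsq
  have h2 : cycleProductSum y (insert a R) = ∑ S ∈ R.powerset, (-1 : ℚ) ^ S.card *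
        ∑ z ∈ cyclesOn (insert a R), signedSum y (insert a S) (R \ S) z := by
    rw [cycleProductSum, Finset.sum_congr rfl fun z _ => sum_cyclesOn_eq_signed_sum ha _,
      Finset.sum_comm]
    exact Finset.sum_congr rfl fun S _ => (Finset.mul_sum _ _ _).symm
  rw [h2, Finset.sum_congr rfl h1, Finset.sum_powerset_apply_card, Finset.sum_range_succ,
    Nat.choose_self, one_smul, hF]
  simp only [if_true]
  rw [mul_add, add_comm, Finset.mul_sum]
  congr 1
  refine Finset.sum_congr rfl fun j hj => ?_
  have hj' := Finset.mem_range.1 hj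
  rw [if_neg hj'.ne, ← Nat.choose_mul_factorial_mul_factorial hj'.le, Nat.factorial_succ,
    nsmul_eq_mul]
  push_cast
  ring

theorem mul_cycleProductSum {R : Finset Y} (hR : R.Nonempty) :
    R.card * (R.card + 1) * (y * cycleProductSum y R)
      = (R.card - 1).factorial * (risingProd y (R.card + 1) - risingProd (-y) (R.card + 1)) := by
  obtain ⟨a, ha⟩ := hR
  obtain ⟨R, haR, rfl⟩ : ∃ R' : Finset Y, a ∉ R' ∧ insert a R' = R :=
    ⟨R.erase a, by simp, Finset.insert_erase ha⟩
  rw [cycleProductSum_insert_eq y haR, Finset.card_insert_of_notMem haR, Nat.add_sub_cancel,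
    ← mul_risingProd_convolution]
  push_cast
  ring

theorem swap_mul_swap_left {Z : Type*} [DecidableEq Z] {a s t : Z} (hta : t ≠ a) (hst : s ≠ t) :
    swap a t * swap a s = swap a s * swap t s := by
  rw [swap_mul_eq_mul_swap, swap_inv, swap_apply_left, swap_apply_of_ne_of_ne hta hst.symm,
    swap_comm s t]

theorem sum_cyclesOn_insert_swap_mul {X : Finset Y} {a t : Y} (ha : a ∉ X) (ht : t ∈ X)
    {τ : Perm Y} (hτ : τ a = a) :
    ∑ w ∈ cyclesOn (insert a X), swapWeight y (swap a t * (w * τ))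
      = ∑ w ∈ cyclesOn X, (swapWeight y (w * τ)
          + y * ∑ s ∈ X.erase t, swapWeight y (swap t s * (w * τ))) := by
  rw [sum_cyclesOn_insert ⟨t, ht⟩ ha, Finset.sum_comm]
  refine Finset.sum_congr rfl fun w hw => ?_
  rw [← Finset.add_sum_erase X _ ht, Finset.mul_sum]
  congr 1
  · rw [mul_assoc, ← mul_assoc, swap_mul_self, one_mul]
  · refine Finset.sum_congr rfl fun s hs => ?_
    obtain ⟨hst, hsX⟩ := Finset.mem_erase.1 hs
    have hsa : s ≠ a := ne_of_mem_of_not_mem hsX ha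
    rw [mul_assoc, ← mul_assoc, swap_mul_swap_left (ne_of_mem_of_not_mem ht ha) hst, mul_assoc,
      swapWeight_swap_mul y _ hsa]
    rw [Perm.mul_apply, Perm.mul_apply, hτ, apply_eq_of_mem_cyclesOn hw ha,
      swap_apply_of_ne_of_ne (ne_of_mem_of_not_mem ht ha).symm hsa.symm]

/-- The sum of the weights of `ρ z w` over pairs of full cycles `z`, `w` on `X`. -/
noncomputable def twistedSum (X : Finset Y) (ρ : Perm Y) : ℚ :=
  ∑ z ∈ cyclesOn X, ∑ w ∈ cyclesOn X, swapWeight y (w * (ρ * z))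

/-- The variant of `twistedSum` with a further transposition of two points of `X`. -/
noncomputable def twistedSwapSum (X : Finset Y) (ρ : Perm Y) : ℚ :=
  ∑ z ∈ cyclesOn X, ∑ w ∈ cyclesOn X, ∑ s ∈ X, ∑ t ∈ X.erase s,
    swapWeight y (swap s t * (w * (ρ * z)))

theorem twistedSum_one (X : Finset Y) : twistedSum y X 1 = cycleProductSum y X := by
  rw [twistedSum, cycleProductSum, Finset.sum_comm]
  simp only [one_mul]

theorem twistedSum_insert {X : Finset Y} (hX : X.Nonempty) {a : Y} (ha : a ∉ X) {ρ : Perm Y}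
    (hρ : ρ a = a) :
    twistedSum y (insert a X) ρ = X.card * twistedSum y X ρ + y * twistedSwapSum y X ρ := by
  rw [twistedSum, sum_cyclesOn_insert_right hX ha, Finset.sum_comm, twistedSum, twistedSwapSum,
    Finset.mul_sum, Finset.mul_sum, ← Finset.sum_add_distrib]
  refine Finset.sum_congr rfl fun z hz => ?_
  have h1 : ∀ s ∈ X, ∑ w ∈ cyclesOn (insert a X), swapWeight y (w * (ρ * (z * swap a s)))
      = ∑ w ∈ cyclesOn X, (swapWeight y (w * (ρ * z))
          + y * ∑ t ∈ X.erase s, swapWeight y (swap s t * (w * (ρ * z)))) := by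
    intro s hs
    rw [← sum_cyclesOn_insert_swap_mul y ha hs]
    · refine Finset.sum_congr rfl fun w _ => ?_
      rw [swapWeight_mul_comm y (swap a s)]
      simp only [mul_assoc]
    · rw [Perm.mul_apply, apply_eq_of_mem_cyclesOn hz ha, hρ]
  rw [Finset.sum_congr rfl h1, Finset.sum_comm, Finset.mul_sum, Finset.mul_sum,
    ← Finset.sum_add_distrib]
  refine Finset.sum_congr rfl fun w _ => ?_
  rw [Finset.sum_add_distrib, Finset.sum_const, nsmul_eq_mul, Finset.mul_sum]

theorem sum_cyclesOn_mul_swap {X : Finset Y} (hX : X.Nonempty) {u v : Y} (hu : u ∉ X)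
    (hv : v ∉ X) (huv : u ≠ v) {h : Perm Y} (hhu : h u = u) (hhv : h v = v) :
    ∑ z ∈ cyclesOn (insert u (insert v X)), swapWeight y (z * (swap u v * h))
      = ∑ z ∈ cyclesOn X, ∑ r ∈ X, (2 * y * swapWeight y (z * h)
          + y ^ 2 * ∑ p ∈ X.erase r, swapWeight y (swap r p * (z * h))) := by
  have hu' : u ∉ insert v X := by simp [huv, hu]
  rw [sum_cyclesOn_insert (by simp) hu', Finset.sum_congr rfl fun p _ =>
    sum_cyclesOn_insert hX hv _]
  simp_rw [Finset.sum_comm (s := X)]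
  rw [Finset.sum_comm]
  refine Finset.sum_congr rfl fun z hz => ?_
  rw [Finset.sum_comm]
  refine Finset.sum_congr rfl fun r hr => ?_
  have hzu : z u = u := apply_eq_of_mem_cyclesOn hz hu
  have hzv : z v = v := apply_eq_of_mem_cyclesOn hz hv
  have hru : r ≠ u := ne_of_mem_of_not_mem hr hu
  have hrv : r ≠ v := ne_of_mem_of_not_mem hr hv
  have hk : ∀ p, swap u p * (swap v r * z) * (swap u v * h)
      = swap u p * swap v r * swap u v * (z * h) := by
    intro p
    have : z * swap u v = swap u v * z := by rw [mul_swap_eq_swap_mul, hzu, hzv]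
    simp only [mul_assoc]
    rw [← mul_assoc z, this, mul_assoc]
  have hku : (z * h) u = u := by rw [Perm.mul_apply, hhu, hzu]
  have hkv : (z * h) v = v := by rw [Perm.mul_apply, hhv, hzv]
  generalize z * h = k at *
  rw [Finset.sum_insert hv, ← Finset.add_sum_erase X _ hr, Finset.mul_sum, ← add_assoc]
  congr 1
  · have h1 : swap u v * swap v r * swap u v = swap u r := by
      ext x
      simp only [Perm.mul_apply, swap_apply_def]
      split_ifs <;> simp_all
    have h2 : swap u r * swap v r * swap u v = swap v r := by
      ext x
      simp only [Perm.mul_apply, swap_apply_def]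
      split_ifs <;> simp_all
    rw [hk, hk, h1, h2, swapWeight_swap_mul y hku hru, swapWeight_swap_mul y hkv hrv]
    ring
  · refine Finset.sum_congr rfl fun p hp => ?_
    obtain ⟨hpr, hpX⟩ := Finset.mem_erase.1 hp
    have hpu : p ≠ u := ne_of_mem_of_not_mem hpX hu
    have hpv : p ≠ v := ne_of_mem_of_not_mem hpX hv
    have h1 : swap u p * swap v r * swap u v = swap u r * (swap v p * swap r p) := by
      rw [mul_assoc, mul_swap_eq_swap_mul (swap v r), swap_apply_left,
        swap_apply_of_ne_of_ne huv hru.symm, ← mul_assoc, swap_mul_swap_left hpu hpr.symm,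
        mul_assoc, mul_swap_eq_swap_mul (swap p r), swap_apply_right,
        swap_apply_of_ne_of_ne hpv.symm hrv.symm, swap_comm p r]
    rw [hk, h1, mul_assoc, mul_assoc, swapWeight_swap_mul y ?_ hru, swapWeight_swap_mul y ?_ hpv]
    · ring
    · rw [Perm.mul_apply, hkv, swap_apply_of_ne_of_ne hrv.symm hpv.symm]
    · rw [Perm.mul_apply, Perm.mul_apply, hku, swap_apply_of_ne_of_ne hru.symm hpu.symm,
        swap_apply_of_ne_of_ne huv hpu.symm]

theorem conj_mem_cyclesOn {S : Finset Y} {σ z : Perm Y} (hσ : σ ∈ permsOn S)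
    (hz : z ∈ cyclesOn S) : σ * z * σ⁻¹ ∈ cyclesOn S := by
  have hz' := cyclesOn_subset S hz
  rw [mem_cyclesOn]
  refine ⟨mem_permsOn.1 (mul_mem_permsOn (mul_mem_permsOn hσ hz') (inv_mem_permsOn hσ)),
    fun T hT hne h => ?_⟩
  have hmap : T.map (σ⁻¹ : Perm Y).toEmbedding = S := by
    refine (mem_cyclesOn.1 hz).2 _ ?_ (hne.map) ?_
    · intro x hx
      obtain ⟨t, ht, rfl⟩ := Finset.mem_map.1 hx
      exact apply_mem_of_mem_permsOn (inv_mem_permsOn hσ) (hT ht)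
    · intro x hx
      obtain ⟨t, ht, rfl⟩ := Finset.mem_map.1 hx
      exact Finset.mem_map.2 ⟨_, h t ht, by simp⟩
  refine hT.antisymm fun x hx => ?_
  have h1 : σ⁻¹ x ∈ T.map (σ⁻¹ : Perm Y).toEmbedding :=
    hmap ▸ apply_mem_of_mem_permsOn (inv_mem_permsOn hσ) hx
  obtain ⟨t, ht, h2⟩ := Finset.mem_map.1 h1
  have h3 : t = x := (σ⁻¹ : Perm Y).injective h2
  exact h3 ▸ ht

theorem sum_cyclesOn_conj {M : Type*} [AddCommMonoid M] {S : Finset Y} {σ : Perm Y}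
    (hσ : σ ∈ permsOn S) (f : Perm Y → M) :
    ∑ z ∈ cyclesOn S, f (σ * z * σ⁻¹) = ∑ z ∈ cyclesOn S, f z :=
  Finset.sum_nbij' (fun z => σ * z * σ⁻¹) (fun z => σ⁻¹ * z * σ)
    (fun _ hz => conj_mem_cyclesOn hσ hz)
    (fun z hz => by simpa using conj_mem_cyclesOn (inv_mem_permsOn hσ) hz)
    (fun _ _ => by group) (fun _ _ => by group) (fun _ _ => rfl)

theorem twistedSum_conj {X : Finset Y} {σ : Perm Y} (hσ : σ ∈ permsOn X) (ρ : Perm Y) :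
    twistedSum y X (σ * ρ * σ⁻¹) = twistedSum y X ρ := by
  rw [twistedSum, twistedSum, ← sum_cyclesOn_conj hσ]
  refine Finset.sum_congr rfl fun z _ => ?_
  rw [← sum_cyclesOn_conj hσ]
  refine Finset.sum_congr rfl fun w _ => ?_
  rw [show σ * w * σ⁻¹ * (σ * ρ * σ⁻¹ * (σ * z * σ⁻¹)) = σ * (w * (ρ * z)) * σ⁻¹ by group,
    swapWeight_mul_comm, inv_mul_cancel_left]

theorem twistedSwapSum_one (X : Finset Y) :
    twistedSwapSum y X 1 = ∑ r ∈ X, ∑ p ∈ X.erase r, twistedSum y X (swap r p) := by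
  simp_rw [twistedSwapSum, twistedSum, one_mul]
  rw [Finset.sum_comm]
  simp_rw [Finset.sum_comm (s := cyclesOn X) (t := X)]
  refine Finset.sum_congr rfl fun r _ => ?_
  simp_rw [Finset.sum_comm (s := cyclesOn X) (t := X.erase r)]
  refine Finset.sum_congr rfl fun p _ => Finset.sum_congr rfl fun z _ =>
    Finset.sum_congr rfl fun w _ => ?_
  rw [← mul_assoc, ← mul_assoc, swapWeight_mul_comm, ← mul_assoc]

theorem card_mul_sum_twistedSum_swap {X : Finset Y} {a : Y} (ha : a ∉ X) :
    (X.card + 1) * ∑ r ∈ X, ∑ p ∈ X.erase r, twistedSum y (insert a X) (swap r p)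
      = (X.card - 1) * ∑ r ∈ insert a X, ∑ p ∈ (insert a X).erase r,
          twistedSum y (insert a X) (swap r p) := by
  have h1 : ∀ r ∈ X, ∀ p ∈ X.erase r, twistedSum y (insert a X) (swap r p)
      = twistedSum y (insert a X) (swap r a) := by
    intro r hr p hp
    obtain ⟨hpr, hpX⟩ := Finset.mem_erase.1 hp
    have hra : r ≠ a := ne_of_mem_of_not_mem hr ha
    rw [← twistedSum_conj y (swap_mem_permsOn (Finset.mem_insert_of_mem hpX)
      (Finset.mem_insert_self a X)) (swap r p), mul_swap_eq_swap_mul, mul_inv_cancel_right,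
      swap_apply_left, swap_apply_of_ne_of_ne hpr.symm hra]
  have h2 : ∀ r ∈ X, ∑ p ∈ X.erase r, twistedSum y (insert a X) (swap r p)
      = (X.card - 1) * twistedSum y (insert a X) (swap r a) := by
    intro r hr
    rw [Finset.sum_congr rfl (h1 r hr), Finset.sum_const, Finset.card_erase_of_mem hr,
      nsmul_eq_mul, Nat.cast_pred (Finset.card_pos.2 ⟨r, hr⟩)]
  have h3 : ∀ r ∈ X, ∑ p ∈ (insert a X).erase r, twistedSum y (insert a X) (swap r p)
      = X.card * twistedSum y (insert a X) (swap r a) := by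
    intro r hr
    have hra : r ≠ a := ne_of_mem_of_not_mem hr ha
    rw [Finset.erase_insert_of_ne hra.symm, Finset.sum_insert (by simp [ha]), h2 r hr]
    ring
  have h4 : ∀ p ∈ X, twistedSum y (insert a X) (swap a p) = twistedSum y (insert a X) (swap p a) :=
    fun p _ => by rw [swap_comm]
  rw [Finset.sum_insert ha, Finset.erase_insert ha, Finset.sum_congr rfl h2,
    Finset.sum_congr rfl h3, Finset.sum_congr rfl h4, ← Finset.mul_sum, ← Finset.mul_sum]
  ring

theorem sum_twisted_mul_swap {X : Finset Y} (hX : X.Nonempty) {c e : Y} (hc : c ∉ X)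
    (he : e ∉ X) (hce : c ≠ e) {ρ : Perm Y} (hρc : ρ c = c) (hρe : ρ e = e) :
    ∑ z ∈ cyclesOn X, ∑ w ∈ cyclesOn (insert c (insert e X)),
        swapWeight y (w * (swap c e * (ρ * z)))
      = y * (X.card * twistedSum y X ρ + twistedSum y (insert c X) ρ) := by
  have h1 : ∀ z ∈ cyclesOn X, ∑ w ∈ cyclesOn (insert c (insert e X)),
        swapWeight y (w * (swap c e * (ρ * z)))
      = 2 * y * X.card * ∑ w ∈ cyclesOn X, swapWeight y (w * (ρ * z))
        + y ^ 2 * ∑ w ∈ cyclesOn X, ∑ s ∈ X, ∑ t ∈ X.erase s,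
          swapWeight y (swap s t * (w * (ρ * z))) := by
    intro z hz
    rw [sum_cyclesOn_mul_swap y hX hc he hce, Finset.mul_sum, Finset.mul_sum,
      ← Finset.sum_add_distrib]
    · refine Finset.sum_congr rfl fun w _ => ?_
      rw [Finset.sum_add_distrib, Finset.sum_const, nsmul_eq_mul, Finset.mul_sum]
      ring
    · rw [Perm.mul_apply, apply_eq_of_mem_cyclesOn hz hc, hρc]
    · rw [Perm.mul_apply, apply_eq_of_mem_cyclesOn hz he, hρe]
  rw [Finset.sum_congr rfl h1, Finset.sum_add_distrib, ← Finset.mul_sum, ← Finset.mul_sum,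
    twistedSum_insert y hX hc hρc]
  simp only [twistedSum, twistedSwapSum]
  ring

/-- The sum of the weights of `(c e) z (u v) w` over the full cycles `z` off `{c, e}` and `w`
off `{u, v}`. -/
noncomputable def swapPairSum (c e u v : Y) : ℚ :=
  ∑ z ∈ cyclesOn ({c, e} : Finset Y)ᶜ, ∑ w ∈ cyclesOn ({u, v} : Finset Y)ᶜ,
    swapWeight y (swap c e * z * (swap u v * w))

theorem swapPairSum_of_disjoint {X : Finset Y} (hX : X.Nonempty) {c e u v : Y} (hc : c ∉ X)
    (he : e ∉ X) (hu : u ∉ X) (hv : v ∉ X) (hce : c ≠ e) (huv : u ≠ v)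
    (hA : ({c, e} : Finset Y)ᶜ = insert u (insert v X))
    (hB : ({u, v} : Finset Y)ᶜ = insert c (insert e X)) :
    (X.card + 1) * swapPairSum y c e u v = y ^ 2 * (
        (X.card + 1) * X.card ^ 2 * cycleProductSum y X
        + (X.card + 1) * (2 * X.card + 1) * cycleProductSum y (insert c X)
        + (X.card - 1) * cycleProductSum y (insert e (insert c X))) := by
  have hcA : c ∉ insert u (insert v X) := by rw [← hA]; simp
  have heA : e ∉ insert u (insert v X) := by rw [← hA]; simp
  have huB : u ∉ insert c (insert e X) := by rw [← hB]; simp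
  have hvB : v ∉ insert c (insert e X) := by rw [← hB]; simp
  simp only [Finset.mem_insert, not_or] at hcA heA huB hvB
  have h1 : swapPairSum y c e u v = ∑ r ∈ X, (2 * y * (y * (X.card * twistedSum y X 1
        + twistedSum y (insert c X) 1))
      + y ^ 2 * ∑ p ∈ X.erase r, y * (X.card * twistedSum y X (swap r p)
        + twistedSum y (insert c X) (swap r p))) := by
    have h2 : ∀ w ∈ cyclesOn (insert c (insert e X)),
        ∑ z ∈ cyclesOn (insert u (insert v X)), swapWeight y (swap c e * z * (swap u v * w))
        = ∑ z ∈ cyclesOn X, ∑ r ∈ X, (2 * y * swapWeight y (w * (swap c e * (1 * z)))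
          + y ^ 2 * ∑ p ∈ X.erase r, swapWeight y (w * (swap c e * (swap r p * z)))) := by
      intro w hw
      have h3 : ∀ z : Perm Y, swapWeight y (swap c e * z * (swap u v * w))
          = swapWeight y (z * (swap u v * (w * swap c e))) := by
        intro z
        rw [mul_assoc, swapWeight_mul_comm]
        simp only [mul_assoc]
      simp_rw [h3]
      rw [sum_cyclesOn_mul_swap y hX hu hv huv]
      · refine Finset.sum_congr rfl fun z _ => Finset.sum_congr rfl fun r _ => ?_
        congr 2
        · rw [one_mul, swapWeight_mul_comm, mul_assoc]
        · refine Finset.sum_congr rfl fun p _ => ?_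
          rw [← mul_assoc, swapWeight_mul_comm, mul_assoc]
      · rw [Perm.mul_apply, swap_apply_of_ne_of_ne huB.1 huB.2.1]
        exact apply_eq_of_mem_cyclesOn hw (by simp [huB])
      · rw [Perm.mul_apply, swap_apply_of_ne_of_ne hvB.1 hvB.2.1]
        exact apply_eq_of_mem_cyclesOn hw (by simp [hvB])
    rw [swapPairSum, hA, hB, Finset.sum_comm, Finset.sum_congr rfl h2]
    simp_rw [Finset.sum_comm (s := cyclesOn X) (t := X)]
    rw [Finset.sum_comm]
    refine Finset.sum_congr rfl fun r hr => ?_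
    rw [Finset.sum_comm (s := cyclesOn (insert c (insert e X)))]
    rw [← sum_twisted_mul_swap y hX hc he hce (ρ := 1) rfl rfl, Finset.mul_sum]
    have h4 : ∀ p ∈ X.erase r, y * (X.card * twistedSum y X (swap r p)
        + twistedSum y (insert c X) (swap r p))
        = ∑ z ∈ cyclesOn X, ∑ w ∈ cyclesOn (insert c (insert e X)),
          swapWeight y (w * (swap c e * (swap r p * z))) := by
      intro p hp
      have hp' := Finset.mem_of_mem_erase hp
      rw [sum_twisted_mul_swap y hX hc he hce]
      · exact swap_apply_of_ne_of_ne (ne_of_mem_of_not_mem hr hc).symm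
          (ne_of_mem_of_not_mem hp' hc).symm
      · exact swap_apply_of_ne_of_ne (ne_of_mem_of_not_mem hr he).symm
          (ne_of_mem_of_not_mem hp' he).symm
    rw [Finset.sum_congr rfl h4, Finset.sum_comm (s := X.erase r) (t := cyclesOn X),
      Finset.mul_sum, ← Finset.sum_add_distrib]
    refine Finset.sum_congr rfl fun z _ => ?_
    rw [Finset.sum_comm, Finset.mul_sum, Finset.mul_sum, ← Finset.sum_add_distrib]
  have hec : e ∉ insert c X := by simp [he, hce.symm]
  have hG := twistedSum_insert y hX hc (ρ := 1) rfl
  have hG' := twistedSum_insert y (X := insert c X) (by simp) hec (ρ := 1) rfl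
  have hA' := card_mul_sum_twistedSum_swap y hc
  rw [twistedSwapSum_one] at hG hG'
  rw [Finset.card_insert_of_notMem hc] at hG'
  simp only [twistedSum_one] at h1 hG hG'
  rw [h1]
  simp only [Finset.sum_add_distrib, ← Finset.mul_sum, Finset.sum_const, nsmul_eq_mul]
  push_cast at hG'
  linear_combination (X.card + 1) * X.card * y ^ 2 * (-hG) + y ^ 3 * hA'
    + y ^ 2 * (X.card - 1) * (-hG')

theorem swapPairSum_self (c e : Y) :
    swapPairSum y c e c e = cycleProductSum y ({c, e} : Finset Y)ᶜ := by
  refine Finset.sum_congr rfl fun z hz => Finset.sum_congr rfl fun w _ => ?_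
  rw [swap_mul_eq_mul_swap, ← mul_assoc]
  have h : ∀ x ∈ ({c, e} : Finset Y), z⁻¹ x = x := fun x hx => by
    rw [Perm.inv_eq_iff_eq, apply_eq_of_mem_cyclesOn hz fun h => Finset.mem_compl.1 h hx]
  rw [h c (by simp), h e (by simp), mul_assoc z, swap_mul_self, mul_one]

theorem swapPairSum_of_common {Q : Finset Y} (hQ : Q.Nonempty) {c e v : Y} (hc : c ∉ Q)
    (he : e ∉ Q) (hv : v ∉ Q) (hce : c ≠ e) (hcv : c ≠ v) (hev : e ≠ v)
    (hA : ({c, e} : Finset Y)ᶜ = insert v Q) (hB : ({c, v} : Finset Y)ᶜ = insert e Q) :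
    swapPairSum y c e c v = y ^ 2 * cycleProductSum y (insert e Q) := by
  have h1 : ∀ z ∈ cyclesOn (insert v Q), ∀ w ∈ cyclesOn (insert e Q),
      swapWeight y (swap c e * z * (swap c v * w)) = y * swapWeight y (swap e v * (w * z)) := by
    intro z hz w hw
    have hzc : z c = c := apply_eq_of_mem_cyclesOn hz (by simp [hc, hcv])
    have hze : z e = e := apply_eq_of_mem_cyclesOn hz (by simp [he, hev])
    have hwc : w c = c := apply_eq_of_mem_cyclesOn hw (by simp [hc, hce])
    have h2 : swap c e * z = z * swap c e := by rw [mul_swap_eq_swap_mul, hzc, hze]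
    have h3 : z * swap c e * (swap c v * w) = z * (swap c v * (swap e v * w)) := by
      rw [mul_assoc, ← mul_assoc (swap c e), swap_mul_swap_left hce.symm hev.symm, mul_assoc]
    rw [h2, h3, swapWeight_mul_comm, mul_assoc, swapWeight_swap_mul y ?_ hcv.symm, mul_assoc]
    rw [Perm.mul_apply, Perm.mul_apply, hzc, hwc, swap_apply_of_ne_of_ne hce hcv]
  have h4 : ∀ w ∈ cyclesOn (insert e Q), ∀ i ∈ Q, ∀ z ∈ cyclesOn Q,
      swapWeight y (swap e v * (w * (z * swap v i))) = y * swapWeight y (z * swap e i * w) := by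
    intro w hw i hi z hz
    have hiv : i ≠ v := ne_of_mem_of_not_mem hi hv
    have hie : i ≠ e := ne_of_mem_of_not_mem hi he
    have hwv : w v = v := apply_eq_of_mem_cyclesOn hw (by simp [hv, hev.symm])
    have hzv : z v = v := apply_eq_of_mem_cyclesOn hz hv
    have h5 : swap v i * (swap e v * (w * z)) = swap v e * (swap i e * (w * z)) := by
      rw [swap_comm e v, ← mul_assoc, swap_mul_swap_left hiv hie.symm, mul_assoc]
    rw [show swap e v * (w * (z * swap v i)) = swap e v * (w * z) * swap v i by
      simp only [mul_assoc], swapWeight_mul_comm, h5, swapWeight_swap_mul y ?_ hev,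
      swap_comm i e, ← mul_assoc, swapWeight_mul_comm, mul_assoc]
    rw [Perm.mul_apply, Perm.mul_apply, hzv, hwv, swap_apply_of_ne_of_ne hiv.symm hev.symm]
  rw [swapPairSum, hA, hB, Finset.sum_congr rfl fun z hz => Finset.sum_congr rfl (h1 z hz),
    Finset.sum_comm]
  have h6 : ∀ w ∈ cyclesOn (insert e Q),
      ∑ z ∈ cyclesOn (insert v Q), y * swapWeight y (swap e v * (w * z))
      = y ^ 2 * ∑ z ∈ cyclesOn (insert e Q), swapWeight y (z * w) := by
    intro w hw
    rw [sum_cyclesOn_insert_right hQ hv, sum_cyclesOn_insert_right hQ he, Finset.mul_sum]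
    refine Finset.sum_congr rfl fun i hi => ?_
    rw [Finset.mul_sum]
    refine Finset.sum_congr rfl fun z hz => ?_
    rw [h4 w hw i hi z hz]
    ring
  rw [Finset.sum_congr rfl h6, ← Finset.mul_sum, cycleProductSum, Finset.sum_comm]

/-- The value of `cycleProductSum` on a set with `k` elements. -/
noncomputable def cycleProductValue (k : ℕ) : ℚ :=
  (k - 1).factorial * (risingProd y (k + 1) - risingProd (-y) (k + 1)) / (k * (k + 1) * y)

theorem cycleProductSum_eq {y : ℚ} (hy : y ≠ 0) {R : Finset Y} (hR : R.Nonempty) :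
    cycleProductSum y R = cycleProductValue y R.card := by
  have h : (R.card : ℚ) ≠ 0 := Nat.cast_ne_zero.2 hR.card_pos.ne'
  rw [cycleProductValue, eq_div_iff (by positivity), ← mul_cycleProductSum y hR]
  ring

theorem swapPairSum_comm_left (c e u v : Y) :
    swapPairSum y e c u v = swapPairSum y c e u v := by
  rw [swapPairSum, swapPairSum, swap_comm, Finset.pair_comm]

theorem swapPairSum_comm_right (c e u v : Y) :
    swapPairSum y c e v u = swapPairSum y c e u v := by
  rw [swapPairSum, swapPairSum, swap_comm v u, Finset.pair_comm v u]

theorem compl_pair_eq_insert {a b c : Y} (hac : a ≠ c) (hbc : b ≠ c) :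
    ({a, b} : Finset Y)ᶜ = insert c ({a, b, c} : Finset Y)ᶜ := by
  ext x
  by_cases h : x = c
  · simp [h, hac.symm, hbc.symm]
  · simp [h]

/-- The total over `u ≠ v` of the sums `swapPairSum y c e u v`, when `Y` has `k + 4` elements. -/
noncomputable def swapPairRow (k : ℕ) : ℚ :=
  2 * cycleProductValue y (k + 2) + 4 * (k + 2) * (y ^ 2 * cycleProductValue y (k + 2))
    + (k + 2) * (y ^ 2 * ((k + 1) * k ^ 2 * cycleProductValue y k
      + (k + 1) * (2 * k + 1) * cycleProductValue y (k + 1)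
      + (k - 1) * cycleProductValue y (k + 2)))

theorem sum_swapPairSum {y : ℚ} (hy : y ≠ 0) {k : ℕ} (hk : 0 < k)
    (hY : Fintype.card Y = k + 4) {c e : Y} (hce : c ≠ e) :
    ∑ u, ∑ v ∈ Finset.univ.erase u, swapPairSum y c e u v = swapPairRow y k := by
  obtain ⟨W, hW⟩ : ∃ W : Finset Y, W = ({c, e} : Finset Y)ᶜ := ⟨_, rfl⟩
  have hcW : c ∉ W := by simp [hW]
  have heW : e ∉ W := by simp [hW]
  have hceW : c ∉ insert e W := by simp [hce, hcW]
  have huniv : (Finset.univ : Finset Y) = insert c (insert e W) := by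
    ext x
    simp only [hW, Finset.mem_univ, Finset.mem_insert, Finset.mem_compl,
      Finset.mem_singleton, true_iff]
    tauto
  have hWcard : W.card = k + 2 := by
    rw [hW, Finset.card_compl, Finset.card_pair hce, hY]
    omega
  have hself : swapPairSum y c e c e = cycleProductValue y (k + 2) := by
    rw [swapPairSum_self, ← hW, cycleProductSum_eq hy (Finset.card_pos.1 (by omega)), hWcard]
  have hcommon : ∀ a b v : Y, a ≠ b → a ≠ v → b ≠ v →
      swapPairSum y a b a v = y ^ 2 * cycleProductValue y (k + 2) := by
    intro a b v hab hav hbv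
    have h3 : ({a, b, v} : Finset Y).card = 3 := Finset.card_eq_three.2 ⟨a, b, v, hab, hav, hbv, rfl⟩
    have hQ : (({a, b, v} : Finset Y)ᶜ).card = k + 1 := by
      rw [Finset.card_compl, h3, hY]
      omega
    have hb : b ∉ ({a, b, v} : Finset Y)ᶜ := by simp
    rw [swapPairSum_of_common y (Finset.card_pos.1 (by omega)) (by simp) hb (by simp) hab hav hbv
      (compl_pair_eq_insert hav hbv), cycleProductSum_eq hy (by simp),
      Finset.card_insert_of_notMem hb, hQ]
    rw [compl_pair_eq_insert hab hbv.symm]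
    congr 2
    rw [Finset.pair_comm]
  have hdisj : ∀ u ∈ W, ∀ v ∈ W.erase u, (k + 1) * swapPairSum y c e u v
      = y ^ 2 * ((k + 1) * k ^ 2 * cycleProductValue y k
        + (k + 1) * (2 * k + 1) * cycleProductValue y (k + 1)
        + (k - 1) * cycleProductValue y (k + 2)) := by
    intro u hu v hv
    obtain ⟨hvu, hv⟩ := Finset.mem_erase.1 hv
    have hvu' : v ∈ W.erase u := Finset.mem_erase.2 ⟨hvu, hv⟩
    obtain ⟨X, hX⟩ : ∃ X : Finset Y, X = (W.erase u).erase v := ⟨_, rfl⟩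
    have hXcard : X.card = k := by
      rw [hX, Finset.card_erase_of_mem hvu', Finset.card_erase_of_mem hu, hWcard]
      omega
    have huX : u ∉ X := by simp [hX]
    have hvX : v ∉ X := by simp [hX]
    have hcX : c ∉ X := by simp [hX, hcW]
    have heX : e ∉ X := by simp [hX, heW]
    have hA : ({c, e} : Finset Y)ᶜ = insert u (insert v X) := by
      rw [← hW, hX, Finset.insert_erase hvu', Finset.insert_erase hu]
    have huc : u ≠ c := ne_of_mem_of_not_mem hu hcW
    have hue : u ≠ e := ne_of_mem_of_not_mem hu heW
    have hvc : v ≠ c := ne_of_mem_of_not_mem hv hcW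
    have hve : v ≠ e := ne_of_mem_of_not_mem hv heW
    have hB : ({u, v} : Finset Y)ᶜ = insert c (insert e X) := by
      ext x
      simp only [hX, hW, Finset.mem_compl, Finset.mem_insert, Finset.mem_singleton,
        Finset.mem_erase]
      by_cases h1 : x = c
      · simp [h1, huc.symm, hvc.symm]
      · by_cases h2 : x = e
        · simp [h2, hue.symm, hve.symm]
        · simp [h1, h2, and_comm]
    have heX' : e ∉ insert c X := by simp [hce.symm, heX]
    have hXne : X.Nonempty := Finset.card_pos.1 (by omega)
    have h := swapPairSum_of_disjoint y hXne hcX heX huX hvX hce hvu.symm hA hB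
    rw [cycleProductSum_eq hy hXne, cycleProductSum_eq hy (by simp),
      cycleProductSum_eq hy (by simp), Finset.card_insert_of_notMem heX',
      Finset.card_insert_of_notMem hcX, hXcard] at h
    exact h
  have hrowW : ∀ u ∈ W, ∑ v ∈ Finset.univ.erase u, swapPairSum y c e u v
      = 2 * (y ^ 2 * cycleProductValue y (k + 2))
        + y ^ 2 * ((k + 1) * k ^ 2 * cycleProductValue y k
        + (k + 1) * (2 * k + 1) * cycleProductValue y (k + 1)
        + (k - 1) * cycleProductValue y (k + 2)) := by
    intro u hu
    have huc : u ≠ c := ne_of_mem_of_not_mem hu hcW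
    have hue : u ≠ e := ne_of_mem_of_not_mem hu heW
    have hk1 : (k + 1 : ℚ) ≠ 0 := by positivity
    have h : ∀ v ∈ W.erase u, swapPairSum y c e u v
        = y ^ 2 * ((k + 1) * k ^ 2 * cycleProductValue y k
        + (k + 1) * (2 * k + 1) * cycleProductValue y (k + 1)
        + (k - 1) * cycleProductValue y (k + 2)) / (k + 1) := fun v hv => by
      rw [eq_div_iff hk1, mul_comm, hdisj u hu v hv]
    rw [huniv, Finset.erase_insert_of_ne huc.symm, Finset.erase_insert_of_ne hue.symm,
      Finset.sum_insert (by simp [hce, hcW]), Finset.sum_insert (by simp [heW]),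
      Finset.sum_congr rfl h, Finset.sum_const, Finset.card_erase_of_mem hu, hWcard,
      swapPairSum_comm_right, hcommon c e u hce huc.symm hue.symm, swapPairSum_comm_right,
      ← swapPairSum_comm_left, hcommon e c u hce.symm hue.symm huc.symm, nsmul_eq_mul,
      show k + 2 - 1 = k + 1 by omega]
    push_cast
    field_simp
    ring
  have hce' : ∀ v ∈ W, swapPairSum y c e c v = y ^ 2 * cycleProductValue y (k + 2) := fun v hv =>
    hcommon c e v hce (ne_of_mem_of_not_mem hv hcW).symm (ne_of_mem_of_not_mem hv heW).symm
  have hec' : ∀ v ∈ W, swapPairSum y c e e v = y ^ 2 * cycleProductValue y (k + 2) := fun v hv => by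
    rw [← swapPairSum_comm_left]
    exact hcommon e c v hce.symm (ne_of_mem_of_not_mem hv heW).symm
      (ne_of_mem_of_not_mem hv hcW).symm
  have hrowc : ∑ v ∈ Finset.univ.erase c, swapPairSum y c e c v = cycleProductValue y (k + 2)
      + (k + 2) * (y ^ 2 * cycleProductValue y (k + 2)) := by
    rw [huniv, Finset.erase_insert hceW, Finset.sum_insert heW, hself, Finset.sum_congr rfl hce',
      Finset.sum_const, hWcard, nsmul_eq_mul]
    push_cast
    ring
  have hrowe : ∑ v ∈ Finset.univ.erase e, swapPairSum y c e e v = cycleProductValue y (k + 2)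
      + (k + 2) * (y ^ 2 * cycleProductValue y (k + 2)) := by
    rw [huniv, Finset.erase_insert_of_ne hce, Finset.erase_insert heW, Finset.sum_insert hcW,
      swapPairSum_comm_right, hself, Finset.sum_congr rfl hec', Finset.sum_const, hWcard,
      nsmul_eq_mul]
    push_cast
    ring
  have hsplit : ∀ f : Y → ℚ, ∑ u, f u = f c + (f e + ∑ u ∈ W, f u) := fun f => by
    rw [huniv, Finset.sum_insert hceW, Finset.sum_insert heW]
  rw [hsplit, hrowc, hrowe, Finset.sum_congr rfl hrowW, Finset.sum_const, hWcard, nsmul_eq_mul,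
    swapPairRow]
  push_cast
  ring

section FullCycleType

variable {n : ℕ}

theorem fullCycleType_conj (σ τ : Perm (Fin n)) :
    fullCycleType (τ * σ * τ⁻¹) = fullCycleType σ := by
  rw [fullCycleType, fullCycleType, cycleType_conj]

theorem cycleType_eq_filter_fullCycleType (σ : Perm (Fin n)) :
    σ.cycleType = (fullCycleType σ).filter (2 ≤ ·) := by
  have h1 : σ.cycleType.filter (2 ≤ ·) = σ.cycleType :=
    Multiset.filter_eq_self.2 fun _ h => two_le_of_mem_cycleType h
  have h2 : (Multiset.replicate (n - σ.cycleType.sum) 1).filter (2 ≤ ·) = 0 :=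
    Multiset.filter_eq_nil.2 fun a h => by
      rw [Multiset.eq_of_mem_replicate h]
      omega
  rw [fullCycleType, Multiset.filter_add, h1, h2, add_zero]

theorem numCycles_add_swapLength (σ : Perm (Fin n)) : numCycles σ + swapLength σ = n := by
  have h1 : ∀ s : Multiset ℕ, (∀ a ∈ s, 2 ≤ a) → Multiset.card s + (s.map (· - 1)).sum = s.sum := by
    intro s
    induction s using Multiset.induction_on with
    | empty => simp
    | cons a s ih =>
      intro h
      have h2 := ih fun b hb => h b (Multiset.mem_cons_of_mem hb)
      have h3 := h a (Multiset.mem_cons_self a s)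
      simp only [Multiset.card_cons, Multiset.map_cons, Multiset.sum_cons]
      omega
  have h4 := h1 σ.cycleType fun _ h => two_le_of_mem_cycleType h
  have h5 : σ.cycleType.sum ≤ n := by
    rw [sum_cycleType]
    simpa using Finset.card_le_univ σ.support
  simp only [numCycles, fullCycleType, swapLength, Multiset.card_add, Multiset.card_replicate]
  omega

theorem mem_permClass {β : Multiset ℕ} {ω : Perm (Fin n)} :
    ω ∈ permClass n β ↔ fullCycleType ω = β := by
  simp [permClass]

theorem swap_mul_mem_permClass (hn : 5 ≤ n) {c e : Fin n} (hce : c ≠ e) {z : Perm (Fin n)}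
    (hz : z ∈ cyclesOn ({c, e} : Finset (Fin n))ᶜ) : swap c e * z ∈ permClass n {2, n - 2} := by
  have hcard : (({c, e} : Finset (Fin n))ᶜ).card = n - 2 := by
    rw [Finset.card_compl, Finset.card_pair hce, Fintype.card_fin]
  obtain ⟨hcyc, hsupp⟩ := isCycle_of_mem_cyclesOn (by omega) hz
  have hdisj : Perm.Disjoint (swap c e) z := by
    rw [disjoint_iff_disjoint_support, hsupp, support_swap hce]
    exact disjoint_compl_right
  have h : (swap c e * z).cycleType = {2, n - 2} := by
    rw [hdisj.cycleType_mul, (isCycle_swap hce).cycleType, hcyc.cycleType, hsupp, hcard,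
      card_support_swap hce]
    rfl
  rw [mem_permClass, fullCycleType, h]
  have : n - (2 + (n - 2)) = 0 := by omega
  simp [this]

theorem exists_of_mem_permClass (hn : 5 ≤ n) {ω : Perm (Fin n)}
    (hω : ω ∈ permClass n {2, n - 2}) : ∃ a b : Fin n, a ≠ b ∧
      swap a b * ω ∈ cyclesOn ({a, b} : Finset (Fin n))ᶜ := by
  have htype : ω.cycleType = {2, n - 2} := by
    rw [cycleType_eq_filter_fullCycleType, mem_permClass.1 hω]
    refine Multiset.filter_eq_self.2 fun a ha => ?_
    simp only [Multiset.insert_eq_cons, Multiset.mem_cons, Multiset.mem_singleton] at ha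
    omega
  obtain ⟨σ, τ, rfl, hdisj, hσ, hcard⟩ := mem_cycleType_iff.1
    (show 2 ∈ ω.cycleType by simp [htype])
  obtain ⟨a, b, hab, rfl⟩ := card_support_eq_two.1 hcard
  have hτtype : τ.cycleType = {n - 2} := by
    rw [hdisj.cycleType_mul, (isCycle_swap hab).cycleType, card_support_swap hab] at htype
    exact (Multiset.cons_inj_right 2).1 htype
  have hτ : τ.IsCycle := card_cycleType_eq_one.1 (by rw [hτtype]; rfl)
  have hτcard : τ.support.card = n - 2 := by
    rw [← sum_cycleType, hτtype, Multiset.sum_singleton]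
  have hsupp : τ.support = ({a, b} : Finset (Fin n))ᶜ := by
    refine Finset.eq_of_subset_of_card_le ?_ ?_
    · rw [← support_swap hab, Finset.subset_compl_iff_disjoint_left]
      exact disjoint_iff_disjoint_support.1 hdisj
    · rw [Finset.card_compl, Finset.card_pair hab, Fintype.card_fin, hτcard]
  refine ⟨a, b, hab, ?_⟩
  rw [← mul_assoc, swap_mul_self, one_mul, ← hsupp]
  exact mem_cyclesOn_support hτ

theorem card_swap_pairs (hn : 5 ≤ n) {ω : Perm (Fin n)} (hω : ω ∈ permClass n {2, n - 2}) :
    ((Finset.univ : Finset (Fin n)).offDiag.filter fun q =>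
      swap q.1 q.2 * ω ∈ cyclesOn ({q.1, q.2} : Finset (Fin n))ᶜ).card = 2 := by
  obtain ⟨a, b, hab, hτ⟩ := exists_of_mem_permClass hn hω
  have hval : ∀ c e : Fin n, swap c e * ω ∈ cyclesOn ({c, e} : Finset (Fin n))ᶜ →
      ω c = e ∧ ω e = c := by
    intro c e h
    have h1 := apply_eq_of_mem_cyclesOn h (x := c) (by simp)
    have h2 := apply_eq_of_mem_cyclesOn h (x := e) (by simp)
    rw [Perm.mul_apply, swap_apply_eq_iff] at h1 h2
    exact ⟨by simpa using h1, by simpa using h2⟩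
  obtain ⟨hωa, hωb⟩ := hval a b hτ
  have hset : ((Finset.univ : Finset (Fin n)).offDiag.filter fun q =>
      swap q.1 q.2 * ω ∈ cyclesOn ({q.1, q.2} : Finset (Fin n))ᶜ) = {(a, b), (b, a)} := by
    ext ⟨c, e⟩
    simp only [Finset.mem_filter, Finset.mem_offDiag, Finset.mem_univ, true_and,
      Finset.mem_insert, Finset.mem_singleton, Prod.mk.injEq]
    constructor
    · rintro ⟨hce, h⟩
      obtain ⟨hωc, hωe⟩ := hval c e h
      by_cases hca : c = a
      · exact Or.inl ⟨hca, by rw [← hωc, hca, hωa]⟩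
      by_cases hcb : c = b
      · exact Or.inr ⟨hcb, by rw [← hωc, hcb, hωb]⟩
      have hea : e ≠ a := fun h => hcb (by rw [← hωe, h, hωa])
      have heb : e ≠ b := fun h => hca (by rw [← hωe, h, hωb])
      exfalso
      have h1 := (mem_cyclesOn.1 hτ).2 {c, e} ?_ (by simp) ?_
      · have h2 := congrArg Finset.card h1
        rw [Finset.card_compl, Finset.card_pair hab, Finset.card_pair hce, Fintype.card_fin] at h2
        omega
      · intro x hx
        rcases Finset.mem_insert.1 hx with rfl | hx
        · simp [hca, hcb]
        · rw [Finset.mem_singleton.1 hx]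
          simp [hea, heb]
      · intro x hx
        rcases Finset.mem_insert.1 hx with rfl | hx
        · rw [Perm.mul_apply, hωc, swap_apply_of_ne_of_ne hea heb]
          simp
        · rw [Finset.mem_singleton.1 hx, Perm.mul_apply, hωe, swap_apply_of_ne_of_ne hca hcb]
          simp
    · rintro (⟨rfl, rfl⟩ | ⟨rfl, rfl⟩)
      · exact ⟨hab, hτ⟩
      · exact ⟨hab.symm, by rwa [swap_comm, Finset.pair_comm]⟩
  rw [hset, Finset.card_pair]
  simp [hab]

theorem sum_offDiag_univ (f : Fin n → Fin n → ℚ) :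
    ∑ q ∈ (Finset.univ : Finset (Fin n)).offDiag, f q.1 q.2
      = ∑ u, ∑ v ∈ Finset.univ.erase u, f u v := by
  rw [Finset.sum_sigma']
  exact Finset.sum_nbij' (fun q => ⟨q.1, q.2⟩) (fun q => (q.1, q.2))
    (fun q hq => by simpa [eq_comm] using hq) (fun q hq => by simpa [eq_comm] using hq)
    (by simp) (by simp) (by simp)

theorem sum_swap_mul_cyclesOn (hn : 5 ≤ n) (f : Perm (Fin n) → ℚ) :
    ∑ u : Fin n, ∑ v ∈ Finset.univ.erase u, ∑ z ∈ cyclesOn ({u, v} : Finset (Fin n))ᶜ,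
        f (swap u v * z) = 2 * ∑ ω ∈ permClass n {2, n - 2}, f ω := by
  rw [← sum_offDiag_univ fun u v => ∑ z ∈ cyclesOn ({u, v} : Finset (Fin n))ᶜ, f (swap u v * z),
    Finset.mul_sum]
  have h1 : ∀ ω ∈ permClass n {2, n - 2}, 2 * f ω
      = ∑ q ∈ (Finset.univ : Finset (Fin n)).offDiag,
        if swap q.1 q.2 * ω ∈ cyclesOn ({q.1, q.2} : Finset (Fin n))ᶜ then f ω else 0 := by
    intro ω hω
    rw [← Finset.sum_filter, Finset.sum_const, card_swap_pairs hn hω]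
    simp
  rw [Finset.sum_congr rfl h1, Finset.sum_comm]
  refine Finset.sum_congr rfl fun q hq => ?_
  have hne : q.1 ≠ q.2 := (Finset.mem_offDiag.1 hq).2.2
  rw [← Finset.sum_filter]
  refine Finset.sum_nbij' (swap q.1 q.2 * ·) (swap q.1 q.2 * ·) (fun z hz => ?_)
    (fun ω hω => (Finset.mem_filter.1 hω).2) (fun z _ => ?_) (fun ω _ => ?_) (fun _ _ => rfl)
  · rw [Finset.mem_filter, ← mul_assoc, swap_mul_self, one_mul]
    exact ⟨swap_mul_mem_permClass hn hne hz, hz⟩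
  · rw [← mul_assoc, swap_mul_self, one_mul]
  · rw [← mul_assoc, swap_mul_self, one_mul]

theorem two_mul_card_permClass (hn : 5 ≤ n) :
    2 * ((permClass n {2, n - 2}).card : ℚ) = n * (n - 1) * (n - 3).factorial := by
  have h := sum_swap_mul_cyclesOn hn fun _ => 1
  rw [Finset.sum_const, nsmul_eq_mul, mul_one] at h
  have h1 : ∀ u : Fin n, ∀ v ∈ Finset.univ.erase u,
      ∑ z ∈ cyclesOn ({u, v} : Finset (Fin n))ᶜ, (1 : ℚ) = (n - 3).factorial := by
    intro u v hv
    have hcard : (({u, v} : Finset (Fin n))ᶜ).card = n - 2 := by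
      rw [Finset.card_compl, Finset.card_pair (Finset.ne_of_mem_erase hv).symm, Fintype.card_fin]
    rw [Finset.sum_const, card_cyclesOn (Finset.card_pos.1 (by omega)), hcard, nsmul_eq_mul,
      mul_one, show n - 2 - 1 = n - 3 by omega]
  rw [← h, Finset.sum_congr rfl fun u _ => Finset.sum_congr rfl (h1 u)]
  simp only [Finset.sum_const, Finset.card_erase_of_mem (Finset.mem_univ _), Finset.card_univ,
    Fintype.card_fin, nsmul_eq_mul]
  rw [Nat.cast_pred (by omega)]
  ring

theorem sum_permClass_mul_eq {β : Multiset ℕ} {σ τ : Perm (Fin n)} (hσ : σ ∈ permClass n β)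
    (hτ : τ ∈ permClass n β) :
    ∑ ω ∈ permClass n β, swapWeight y (σ * ω) = ∑ ω ∈ permClass n β, swapWeight y (τ * ω) := by
  obtain ⟨π, rfl⟩ : ∃ π, π * τ * π⁻¹ = σ := by
    rw [← isConj_iff, isConj_iff_cycleType_eq, cycleType_eq_filter_fullCycleType,
      cycleType_eq_filter_fullCycleType, mem_permClass.1 hσ, mem_permClass.1 hτ]
  refine Finset.sum_nbij' (fun ω => π⁻¹ * ω * π) (fun ω => π * ω * π⁻¹) (fun ω hω => ?_)
    (fun ω hω => ?_) (fun _ _ => by group) (fun _ _ => by group) (fun ω _ => ?_)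
  · have := fullCycleType_conj ω π⁻¹
    rw [inv_inv] at this
    rw [mem_permClass, this, mem_permClass.1 hω]
  · rw [mem_permClass, fullCycleType_conj, mem_permClass.1 hω]
  · rw [swapWeight_mul_comm, show τ * (π⁻¹ * ω * π) = π⁻¹ * (π * τ * π⁻¹ * ω) * π by group,
      mul_assoc π⁻¹, swapWeight_mul_comm _ π⁻¹, mul_inv_cancel_right, swapWeight_mul_comm]

theorem factorial_mul_sum_permClass {y : ℚ} (hy : y ≠ 0) {k : ℕ} (hk : 0 < k)
    {α : Perm (Fin (k + 4))} (hα : α ∈ permClass (k + 4) {2, k + 4 - 2}) :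
    2 * (k + 1).factorial * ∑ ω ∈ permClass (k + 4) {2, k + 4 - 2}, swapWeight y (α * ω)
      = swapPairRow y k := by
  have hn : 5 ≤ k + 4 := by omega
  have h1 := sum_swap_mul_cyclesOn hn fun σ =>
    ∑ ω ∈ permClass (k + 4) {2, k + 4 - 2}, swapWeight y (σ * ω)
  rw [Finset.sum_congr rfl fun σ hσ => sum_permClass_mul_eq y hσ hα, Finset.sum_const,
    nsmul_eq_mul] at h1
  have h2 : ∀ c : Fin (k + 4), ∀ e ∈ Finset.univ.erase c,
      2 * ∑ z ∈ cyclesOn ({c, e} : Finset (Fin (k + 4)))ᶜ,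
        ∑ ω ∈ permClass (k + 4) {2, k + 4 - 2}, swapWeight y (swap c e * z * ω)
      = swapPairRow y k := by
    intro c e he
    rw [← sum_swapPairSum hy hk (Fintype.card_fin _) (Finset.ne_of_mem_erase he).symm,
      Finset.mul_sum, Finset.sum_congr rfl fun z _ => (sum_swap_mul_cyclesOn hn fun ω =>
        swapWeight y (swap c e * z * ω)).symm, Finset.sum_comm]
    refine Finset.sum_congr rfl fun u _ => ?_
    rw [Finset.sum_comm]
    rfl
  have h3 := Finset.sum_congr rfl fun c (_ : c ∈ Finset.univ) => Finset.sum_congr rfl (h2 c)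
  simp only [← Finset.mul_sum] at h3
  rw [h1] at h3
  simp only [Finset.sum_const, Finset.card_erase_of_mem (Finset.mem_univ _), Finset.card_univ,
    Fintype.card_fin, nsmul_eq_mul] at h3
  have h4 := two_mul_card_permClass hn
  rw [show k + 4 - 3 = k + 1 by omega] at h4
  rw [Nat.cast_pred (by omega)] at h3
  push_cast at h3 h4
  have h5 : ((k : ℚ) + 4) * (k + 4 - 1) ≠ 0 := by
    have : (0 : ℚ) ≤ k := Nat.cast_nonneg k
    have : (k : ℚ) + 4 - 1 = k + 3 := by ring
    rw [this]
    positivity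
  refine mul_left_cancel₀ h5 ?_
  simp only [Nat.reduceSubDiff]
  linear_combination h3 - 2 * (∑ ω ∈ permClass (k + 4) {2, k + 2}, swapWeight y (α * ω)) * h4

end FullCycleType

section Evaluation

theorem eval_binomPoly_natCast (c : ℤ) (k : ℕ) (x : ℚ) :
    (binomPoly c k).eval x = (descPochhammer ℚ k).eval (x + c) / k.factorial := by
  simp [binomPoly, div_eq_inv_mul]

theorem descPochhammer_eval_succ (k : ℕ) (x : ℚ) :
    (descPochhammer ℚ (k + 1)).eval x = (descPochhammer ℚ k).eval x * (x - k) := by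
  simp [descPochhammer_succ_right]

theorem descPochhammer_eval_add_one (k : ℕ) (x : ℚ) :
    (descPochhammer ℚ (k + 1)).eval (x + 1) = (x + 1) * (descPochhammer ℚ k).eval x := by
  simp [descPochhammer_succ_left]

theorem descPochhammer_eval_eq_risingProd {x : ℚ} (hx : x ≠ 0) (k : ℕ) :
    (descPochhammer ℚ k).eval x = x ^ k * risingProd (-x⁻¹) k := by
  induction k with
  | zero => simp [risingProd_zero]
  | succ k ih =>
    rw [descPochhammer_eval_succ, ih, risingProd_succ]
    field_simp
    ring

theorem descPochhammer_eval_add_eq_risingProd {x : ℚ} (hx : x ≠ 0) (k : ℕ) :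
    (descPochhammer ℚ (k + 1)).eval (x + k) = x ^ (k + 1) * risingProd x⁻¹ (k + 1) := by
  induction k with
  | zero => simp [risingProd_one]
  | succ k ih =>
    rw [Nat.cast_succ, ← add_assoc, descPochhammer_eval_add_one, ih, risingProd_succ _ (k + 1)]
    push_cast
    field_simp
    ring

theorem pow_mul_swapPairRow {x : ℚ} (hx : x ≠ 0) {k : ℕ} (hk : 0 < k) :
    x ^ (k + 4) * swapPairRow x⁻¹ k = (k + 1).factorial ^ 2 *
      (x * (x + 1) *
        ((binomPoly (k + 3) (k + 2 : ℕ)).eval x + (binomPoly (-1) (k + 2 : ℕ)).eval x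
          + (binomPoly 0 (k + 2 : ℕ)).eval x + (binomPoly (k + 1) (k + 3 : ℕ)).eval x
          - (binomPoly 2 (k + 3 : ℕ)).eval x)
      + x * (x - 1) *
        ((binomPoly (-2) (k + 2 : ℕ)).eval x + (binomPoly (k + 2) (k + 2 : ℕ)).eval x
          + (binomPoly (k + 1) (k + 2 : ℕ)).eval x + (binomPoly k (k + 3 : ℕ)).eval x
          - (binomPoly 1 (k + 3 : ℕ)).eval x)) := by
  obtain ⟨U, hU⟩ : ∃ U, U = (descPochhammer ℚ (k + 1)).eval (x + k) := ⟨_, rfl⟩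
  obtain ⟨V, hV⟩ : ∃ V, V = (descPochhammer ℚ (k + 1)).eval x := ⟨_, rfl⟩
  have hs := descPochhammer_eval_succ
  have ha := descPochhammer_eval_add_one
  have u0 : (descPochhammer ℚ (k + 3)).eval (x + k) = U * (x - 1) * (x - 2) := by
    rw [hs, hs, ← hU]
    push_cast
    ring
  have u1 : (descPochhammer ℚ (k + 2)).eval (x + (k + 1)) = (x + k + 1) * U := by
    rw [← add_assoc, ha, hU]
  have u2 : (descPochhammer ℚ (k + 3)).eval (x + (k + 1)) = (x + k + 1) * U * (x - 1) := by
    rw [hs, u1]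
    push_cast
    ring
  have u3 : (descPochhammer ℚ (k + 2)).eval (x + (k + 2)) * x
      = (x + k + 2) * ((x + k + 1) * U) := by
    have h := hs (k + 2) (x + (k + 1) + 1)
    rw [ha, u1] at h
    rw [show x + (k + 2 : ℚ) = x + (k + 1) + 1 by ring]
    push_cast at h
    linear_combination -h
  have u4 : (descPochhammer ℚ (k + 2)).eval (x + (k + 3)) * (x + 1) * x
      = (x + k + 3) * ((x + k + 2) * ((x + k + 1) * U)) := by
    have h := hs (k + 2) (x + (k + 2) + 1)
    rw [ha] at h
    rw [show x + (k + 3 : ℚ) = x + (k + 2) + 1 by ring]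
    push_cast at h
    linear_combination -x * h + (x + k + 3) * u3
  have v0 : (descPochhammer ℚ (k + 2)).eval x = V * (x - (k + 1)) := by
    rw [hs, ← hV]
    push_cast
    ring
  have v1 : (descPochhammer ℚ (k + 3)).eval (x + 1) = (x + 1) * (V * (x - (k + 1))) := by
    rw [ha, v0]
  have v2 : (descPochhammer ℚ (k + 3)).eval (x + 2) = (x + 2) * ((x + 1) * V) := by
    rw [show x + 2 = x + 1 + 1 by ring, ha, ha, hV]
  have v3 : x * (descPochhammer ℚ (k + 2)).eval (x + -1)
      = V * (x - (k + 1)) * (x - (k + 2)) := by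
    have h := ha (k + 2) (x + -1)
    rw [neg_add_cancel_right, hs, v0] at h
    push_cast at h
    linear_combination -h
  have v4 : x * (x - 1) * (descPochhammer ℚ (k + 2)).eval (x + -2)
      = V * (x - (k + 1)) * (x - (k + 2)) * (x - (k + 3)) := by
    have h := ha (k + 2) (x + -2)
    rw [show x + -2 + 1 = x + -1 by ring, hs] at h
    push_cast at h
    linear_combination -x * h + (x - (k + 3)) * v3
  simp only [eval_binomPoly_natCast]
  push_cast
  rw [u0, u1, u2, add_zero, v0, v1, v2]
  have hD : x ^ (k + 4) * swapPairRow x⁻¹ k = (k + 1).factorial ^ 2 *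
      (((x + k + 3) * ((x + k + 2) * ((x + k + 1) * U))
          + (x + 1) * (V * (x - (k + 1)) * (x - (k + 2)))
          + x * (x + 1) * (V * (x - (k + 1)))
          + V * (x - (k + 1)) * (x - (k + 2)) * (x - (k + 3))
          + (x - 1) * ((x + k + 2) * ((x + k + 1) * U))
          + x * (x - 1) * ((x + k + 1) * U)) / (k + 2).factorial
        + (x * (x + 1) * ((x + k + 1) * U * (x - 1)) - x * (x + 1) * ((x + 2) * ((x + 1) * V))
          + x * (x - 1) * (U * (x - 1) * (x - 2))
          - x * (x - 1) * ((x + 1) * (V * (x - (k + 1))))) / (k + 3).factorial) := by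
    rw [descPochhammer_eval_add_eq_risingProd hx] at hU
    rw [descPochhammer_eval_eq_risingProd hx] at hV
    obtain ⟨j, rfl⟩ : ∃ j, k = j + 1 := ⟨k - 1, by omega⟩
    subst hU hV
    simp only [swapPairRow, cycleProductValue, risingProd_succ _ (j + 1 + 1),
      risingProd_succ _ (j + 1 + 1 + 1), Nat.add_sub_cancel,
      show j + 1 + 2 - 1 = j + 2 by omega, show j + 1 + 2 = j + 1 + 1 + 1 by omega,
      show j + 1 + 3 = j + 1 + 1 + 1 + 1 by omega, Nat.factorial_succ]
    have hj : (j.factorial : ℚ) ≠ 0 := Nat.cast_ne_zero.2 j.factorial_ne_zero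
    push_cast
    field_simp
    ring
  linear_combination hD
    - ((k + 1).factorial ^ 2 / (k + 2).factorial : ℚ) * (u4 + (x + 1) * v3 + v4 + (x - 1) * u3)

theorem pow_numCycles {n : ℕ} {x : ℚ} (hx : x ≠ 0) (σ : Perm (Fin n)) :
    x ^ numCycles σ = x ^ n * swapWeight x⁻¹ σ := by
  have h : x ^ n = x ^ numCycles σ * x ^ swapLength σ := by
    rw [← pow_add, numCycles_add_swapLength]
  rw [h, swapWeight, inv_pow, mul_inv_cancel_right₀ (pow_ne_zero _ hx)]

theorem eval_Pperm {x : ℚ} (hx : x ≠ 0) {k : ℕ} (hk : 0 < k) {α : Perm (Fin (k + 4))}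
    (hα : fullCycleType α = {2, k + 4 - 2}) :
    (k + 1).factorial ^ 2 * (Pperm α {2, k + 4 - 2}).eval x = x ^ (k + 4) * swapPairRow x⁻¹ k := by
  have hcard := two_mul_card_permClass (n := k + 4) (by omega)
  have hC : ((permClass (k + 4) {2, k + 4 - 2}).card : ℚ) ≠ 0 :=
    Nat.cast_ne_zero.2 (Finset.card_pos.2 ⟨α, mem_permClass.2 hα⟩).ne'
  rw [← factorial_mul_sum_permClass (inv_ne_zero hx) hk (mem_permClass.2 hα), Pperm, eval_mul,
    eval_C, eval_finsetSum]
  simp only [eval_pow, eval_X, pow_numCycles hx, ← Finset.mul_sum]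
  rw [show k + 4 - 3 = k + 1 by omega] at hcard
  generalize permClass (k + 4) {2, k + 4 - 2} = C at hcard hC ⊢
  field_simp
  linear_combination -(∑ ω ∈ C, swapWeight (1 / x) (α * ω)) * hcard

end Evaluation

end SwapWeights

/-- explicit formula for `P_{[2,n−2],[2,n−2]}(x)`, `n ≥ 5`. -/
theorem Pperm_beta_two_formula (n : ℕ) (hn : 5 ≤ n)
    (α : Equiv.Perm (Fin n)) (hα : fullCycleType α = ({2, n - 2} : Multiset ℕ)) :
    Pperm α ({2, n - 2} : Multiset ℕ) =
      Polynomial.X * (Polynomial.X + 1) *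
        (binomPoly ((n : ℤ) - 1) ((n : ℤ) - 2) + binomPoly (-1) ((n : ℤ) - 2)
          + binomPoly 0 ((n : ℤ) - 2) + binomPoly ((n : ℤ) - 3) ((n : ℤ) - 1)
          - binomPoly 2 ((n : ℤ) - 1))
      + Polynomial.X * (Polynomial.X - 1) *
        (binomPoly (-2) ((n : ℤ) - 2) + binomPoly ((n : ℤ) - 2) ((n : ℤ) - 2)
          + binomPoly ((n : ℤ) - 3) ((n : ℤ) - 2) + binomPoly ((n : ℤ) - 4) ((n : ℤ) - 1)
          - binomPoly 1 ((n : ℤ) - 1)) := by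
  obtain ⟨k, rfl⟩ : ∃ k, n = k + 4 := ⟨n - 4, by omega⟩
  have hk : 0 < k := by omega
  rw [show ((k + 4 : ℕ) : ℤ) - 1 = (k + 3 : ℕ) by push_cast; ring,
    show ((k + 4 : ℕ) : ℤ) - 2 = (k + 2 : ℕ) by push_cast; ring,
    show ((k + 4 : ℕ) : ℤ) - 3 = k + 1 by push_cast; ring,
    show ((k + 4 : ℕ) : ℤ) - 4 = k by push_cast; ring]
  refine eq_of_infinite_eval_eq _ _ ((Set.finite_singleton (0 : ℚ)).infinite_compl.mono ?_)
  intro x hx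
  have hx : x ≠ 0 := hx
  have hf : ((k + 1).factorial : ℚ) ^ 2 ≠ 0 :=
    pow_ne_zero 2 (Nat.cast_ne_zero.2 (Nat.factorial_ne_zero _))
  refine mul_left_cancel₀ hf ?_
  rw [eval_Pperm hx hk hα, pow_mul_swapPairRow hx hk]
  simp only [eval_add, eval_sub, eval_mul, eval_X, eval_one, Nat.cast_add, Nat.cast_ofNat]
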